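/- arXiv:1310.5788 — 4 statements merged into one kernel-verified Lean document; each statement's English description precedes it below -/
import Mathlib

section
/- Each of the five graphs K_{3,3}, K_5, the cube C, the octahedron O, and H has width at least 4. Indeed, none of K_{3,3}, K_5, C, O has a 3-separation (A,B) with |A| ≥ 4 and |B| ≥ 4, and H has no 3-separation (A,B) with |A| ≥ 5 and |B| ≥ 5. -/
/-!  Common definitions: multigraphs, separations, width, minors,
Kirchhoff/Dodgson polynomials, Feynman 5-splitting, enhanced graphs. -/

noncomputable section

attribute [local instance] Classical.propDecidable

/-- A finite multigraph, given by finite vertex and edge types together with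
source and target maps (an arbitrary orientation of each edge). -/
structure Multigraph : Type 1 where
  V : Type
  E : Type
  [fintypeV : Fintype V]
  [fintypeE : Fintype E]
  src : E → V
  tgt : E → V

attribute [instance] Multigraph.fintypeV Multigraph.fintypeE

namespace Multigraph

variable (G : Multigraph)

/-- The endpoints of an edge as an unordered pair. -/
def ends (e : G.E) : Sym2 G.V := s(G.src e, G.tgt e)

/-- Incidence of a vertex with an edge. -/
def inc (v : G.V) (e : G.E) : Prop := v = G.src e ∨ v = G.tgt e

/-- `V(G_A)`: the vertices of the subgraph induced by an edge set `A`. -/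
def edgeVerts (A : Set G.E) : Set G.V := {v | ∃ e ∈ A, G.inc v e}

/-- The order of the separation `(A, Aᶜ)` of the graph `G`,
i.e. `|V(G_A) ∩ V(G_B)|` where `B = Aᶜ`. -/
def sepOrder (A : Set G.E) : ℕ := (G.edgeVerts A ∩ G.edgeVerts Aᶜ).ncard

/-- One step along an edge belonging to the edge set `A`. -/
def stepOn (A : Set G.E) (a b : G.V) : Prop :=
  ∃ e ∈ A, (G.src e = a ∧ G.tgt e = b) ∨ (G.src e = b ∧ G.tgt e = a)

/-- Reachability using only edges in `A`. -/
def reachOn (A : Set G.E) : G.V → G.V → Prop := Relation.ReflTransGen (G.stepOn A)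

/-- Adjacency. -/
def Adj (a b : G.V) : Prop := G.stepOn Set.univ a b

/-- One adjacency step staying inside the vertex set `U`. -/
def stepWithin (U : Set G.V) (a b : G.V) : Prop := a ∈ U ∧ b ∈ U ∧ G.Adj a b

/-- The subgraph induced by the vertex set `U` is (nonempty and) connected. -/
def ConnectedWithin (U : Set G.V) : Prop :=
  U.Nonempty ∧ ∀ a ∈ U, ∀ b ∈ U, Relation.ReflTransGen (G.stepWithin U) a b

/-- Connectivity of the multigraph. -/
def Connected : Prop := G.ConnectedWithin Set.univ

/-- A multigraph is simple if it has no loops and no parallel edges. -/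
def Simple : Prop := (∀ e : G.E, G.src e ≠ G.tgt e) ∧ Function.Injective G.ends

/-- 3-connectivity: at least 4 vertices, and removing fewer than 3 vertices
leaves a connected graph. -/
def ThreeConnected : Prop :=
  4 ≤ Fintype.card G.V ∧ ∀ S : Set G.V, S.ncard < 3 → G.ConnectedWithin Sᶜ

/-- The spanning subgraph with edge set `T` is connected. -/
def ConnectedOn (T : Set G.E) : Prop := ∀ a b : G.V, G.reachOn T a b

/-- The degree of `v` in the spanning subgraph with edge set `T`
(loops count twice). -/
def degOn (T : Set G.E) (v : G.V) : ℕ :=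
  ({e ∈ T | G.src e = v}).ncard + ({e ∈ T | G.tgt e = v}).ncard

/-- The degree of a vertex (loops count twice). -/
def degree (v : G.V) : ℕ := G.degOn Set.univ v

/-- An edge set is a forest (contains no cycle) iff every nonempty subset
has a vertex of degree exactly one. -/
def IsForest (T : Set G.E) : Prop :=
  ∀ T' ⊆ T, T'.Nonempty → ∃ v : G.V, G.degOn T' v = 1

/-- `T` is the edge set of a spanning tree of `G`. -/
def IsSpanningTree (T : Set G.E) : Prop := G.IsForest T ∧ G.ConnectedOn T

/-- The rank of an edge set in the cycle matroid `M(G)`: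
the size of a largest forest contained in it. -/
def rk (A : Set G.E) : ℕ := sSup {n | ∃ T ⊆ A, G.IsForest T ∧ T.ncard = n}

/-- The order of the separation `(A, Aᶜ)` in the cycle matroid `M(G)`,
namely `r(A) + r(Aᶜ) - r(E) + 1`. -/
def msepOrder (A : Set G.E) : ℕ := G.rk A + G.rk Aᶜ + 1 - G.rk Set.univ

/-- The number of connected components of `G_A`, the subgraph induced by the
edge set `A`. -/
def ncompOn (A : Set G.E) : ℕ :=
  ({C : Set G.V | ∃ v ∈ G.edgeVerts A, C = {w | G.reachOn A v w}}).ncard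

/-- `G` has an edge ordering of width at most `k`: every prefix/suffix
separation has order at most `k`. -/
def WidthLE (k : ℕ) : Prop :=
  ∃ f : Fin (Fintype.card G.E) ≃ G.E,
    ∀ ℓ : ℕ,
      G.sepOrder {e | ∃ i : Fin (Fintype.card G.E), f i = e ∧ (i : ℕ) < ℓ} ≤ k

/-- The width of `G`: the minimum width of an edge ordering. -/
def width : ℕ := sInf {k | G.WidthLE k}

/-- The minor of `G` obtained by deleting the edges in `D` and contracting the
edges in `C`. -/
def minorDC (D C : Set G.E) : Multigraph :=
  let rel : G.V → G.V → Prop := fun a b => ∃ e ∈ C, G.src e = a ∧ G.tgt e = b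
  { V := Quot rel
    E := {e : G.E // e ∉ D ∪ C}
    fintypeV := @Fintype.ofFinite _ (Finite.of_surjective (Quot.mk rel) fun q => Quot.exists_rep q)
    fintypeE := Fintype.ofFinite _
    src := fun e => Quot.mk rel (G.src e.1)
    tgt := fun e => Quot.mk rel (G.tgt e.1) }

/-- Deletion of a vertex (together with all incident edges). -/
def deleteVertex (v : G.V) : Multigraph :=
  { V := {w : G.V // w ≠ v}
    E := {e : G.E // ¬ G.inc v e}
    fintypeV := Fintype.ofFinite _
    fintypeE := Fintype.ofFinite _
    src := fun e => ⟨G.src e.1, fun h => e.2 (Or.inl h.symm)⟩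
    tgt := fun e => ⟨G.tgt e.1, fun h => e.2 (Or.inr h.symm)⟩ }

/-- The edges having one endpoint in `X` and the other in `Y`. -/
def crossEdges (X Y : Set G.V) : Set G.E :=
  {e | (G.src e ∈ X ∧ G.tgt e ∈ Y) ∨ (G.src e ∈ Y ∧ G.tgt e ∈ X)}

/-- `G` has `R` as a minor, via branch sets. -/
def HasMinor (R : Multigraph) : Prop :=
  ∃ X : R.V → Set G.V,
    (∀ v : R.V, G.ConnectedWithin (X v)) ∧
    (Pairwise fun v w => Disjoint (X v) (X w)) ∧
    ∀ v w : R.V, v ≠ w →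
      ({f : R.E | R.ends f = s(v, w)}).ncard ≤ (G.crossEdges (X v) (X w)).ncard

/-- `D` is the edge set of a cycle of `G`. -/
def IsCycleSet (D : Set G.E) : Prop :=
  D.Nonempty ∧ (∀ v ∈ G.edgeVerts D, G.degOn D v = 2) ∧
    ∀ a ∈ G.edgeVerts D, ∀ b ∈ G.edgeVerts D, G.reachOn D a b

/-- The side `A` of a separation on `X` is rich: for every `x ∈ X` there is a
cycle `D` avoiding `x` with at most one edge outside `A`. -/
def Rich (A : Set G.E) (X : Set G.V) : Prop :=
  ∀ x ∈ X, ∃ D : Set G.E, G.IsCycleSet D ∧ x ∉ G.edgeVerts D ∧ (D \ A).ncard ≤ 1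

/-- The entry of the (edge × vertex) incidence matrix, as a polynomial. -/
def incCol (e : G.E) (v : G.V) : MvPolynomial G.E ℤ :=
  (if G.src e = v then 1 else 0) - (if G.tgt e = v then 1 else 0)

/-- The expanded Kirchhoff matrix `M_G` (with the column of `v0` deleted). -/
def bigMatrix (v0 : G.V) :
    Matrix (G.E ⊕ {v : G.V // v ≠ v0}) (G.E ⊕ {v : G.V // v ≠ v0}) (MvPolynomial G.E ℤ) :=
  Matrix.of fun r c =>
    match r, c with
    | Sum.inl e, Sum.inl f => if e = f then MvPolynomial.X e else 0
    | Sum.inl e, Sum.inr v => G.incCol e v.1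
    | Sum.inr v, Sum.inl e => - G.incCol e v.1
    | Sum.inr _, Sum.inr _ => 0

/-- The Dodgson polynomial `Ψ^{I,J}_K`: delete the rows indexed by `I` and the
columns indexed by `J` from `M_G`, take the determinant, and set `x_e = 0`
for `e ∈ K`.  (It is well defined up to an overall sign.) -/
def dodgson (v0 : G.V) (I J K : Set G.E) : MvPolynomial G.E ℤ :=
  if h : Nonempty ({e : G.E // e ∉ I} ≃ {e : G.E // e ∉ J}) then
    MvPolynomial.aeval (fun e => if e ∈ K then (0 : MvPolynomial G.E ℤ) else MvPolynomial.X e)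
      (Matrix.det (Matrix.of fun r c =>
        G.bigMatrix v0 (Sum.map Subtype.val id r) (Sum.map (fun x => (h.some x).1) id c)))
  else 0

/-- `(I,J,K)` is one of the 30 Dodgson configurations associated with the
5-configuration `S`. -/
def DodgsonConfig (S I J K : Set G.E) : Prop :=
  I ∪ J ∪ K = S ∧
    ((I.ncard = 2 ∧ J.ncard = 2 ∧ K.ncard = 1 ∧ I ∩ J = ∅ ∧ I ∩ K = ∅ ∧ J ∩ K = ∅) ∨
      (I.ncard = 3 ∧ J.ncard = 3 ∧ K = ∅ ∧ (I ∩ J).ncard = 1))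

/-- The 5-configuration `S` splits: one of its 30 associated Dodgson
polynomials is identically zero. -/
def ConfigSplits (S : Set G.E) : Prop :=
  ∃ I J K : Set G.E, G.DodgsonConfig S I J K ∧ ∀ v0 : G.V, G.dodgson v0 I J K = 0

/-- `G` is Feynman 5-split: every 5-configuration splits. -/
def FeynmanSplit : Prop := ∀ S : Set G.E, S.ncard = 5 → G.ConfigSplits S

/-- `(U, F)` is a subgraph of `G` (every edge of `F` has both ends in `U`). -/
def IsSubgraphPair (U : Set G.V) (F : Set G.E) : Prop :=
  ∀ e ∈ F, G.src e ∈ U ∧ G.tgt e ∈ U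

/-- `G` decomposes into edge-disjoint subgraphs `G₁ ∪ G₂ = G` with
`|V(G₁) ∩ V(G₂)| ≤ 2` and `|E(G₁) ∩ S| = 2`, or with
`|V(G₁) ∩ V(G₂)| = 1` and `|E(G₁) ∩ S| = 1`. -/
def splitWitness (S : Set G.E) : Prop :=
  ∃ (U1 U2 : Set G.V) (F1 F2 : Set G.E),
    G.IsSubgraphPair U1 F1 ∧ G.IsSubgraphPair U2 F2 ∧
    Disjoint F1 F2 ∧ U1 ∪ U2 = Set.univ ∧ F1 ∪ F2 = Set.univ ∧
    (((U1 ∩ U2).ncard ≤ 2 ∧ (F1 ∩ S).ncard = 2) ∨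
      ((U1 ∩ U2).ncard = 1 ∧ (F1 ∩ S).ncard = 1))

/-- A separation of order at most 1 with edges of `S` on both sides, or a
("bad") 2-separation with `min{|A ∩ S|, |B ∩ S|} = 2`. -/
def badSplitSep (S : Set G.E) : Prop :=
  ∃ A : Set G.E,
    (G.sepOrder A ≤ 1 ∧ (A ∩ S).Nonempty ∧ (Aᶜ ∩ S).Nonempty) ∨
      (G.sepOrder A = 2 ∧ min (A ∩ S).ncard (Aᶜ ∩ S).ncard = 2)

/-- Isomorphism of multigraphs. -/
def IsoTo (G' : Multigraph) : Prop :=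
  ∃ (α : G.V ≃ G'.V) (β : G.E ≃ G'.E),
    ∀ e : G.E, G'.ends (β e) = Sym2.map α (G.ends e)

/-- `G` is a tree. -/
def IsTree : Prop := G.Connected ∧ G.IsForest Set.univ

/-- Every vertex has degree 1 or 3. -/
def IsCubic : Prop := ∀ v : G.V, G.degree v = 1 ∨ G.degree v = 3

/-- A leaf. -/
def IsLeaf (v : G.V) : Prop := G.degree v = 1

/-- A cubic caterpillar: a cubic tree whose non-leaf vertices induce a path. -/
def IsCubicCaterpillar : Prop :=
  G.IsTree ∧ G.IsCubic ∧
    (∀ a ∈ {v : G.V | ¬ G.IsLeaf v}, ∀ b ∈ {v : G.V | ¬ G.IsLeaf v},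
      Relation.ReflTransGen (G.stepWithin {v : G.V | ¬ G.IsLeaf v}) a b) ∧
    ∀ v : G.V, ¬ G.IsLeaf v →
      ({e : G.E | G.inc v e ∧ ∃ w : G.V, ¬ G.IsLeaf w ∧ G.inc w e ∧ w ≠ v}).ncard ≤ 2

/-- The branch decomposition `(T, φ)` of the cycle matroid `M(G)` has width at
most `k`: removing any edge `f` of `T` gives a separation of the ground set
of matroid order at most `k`. -/
def branchWidthLE (T : Multigraph) (φ : G.E → T.V) (k : ℕ) : Prop :=
  ∀ f : T.E,
    G.msepOrder {e : G.E | φ e ∈ {x : T.V | T.reachOn {f}ᶜ (T.src f) x}} ≤ k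

/-- `(T, φ)` is a branch decomposition of `M(G)` over a cubic caterpillar. -/
def IsCatDecomp (T : Multigraph) (φ : G.E → T.V) : Prop :=
  T.IsCubicCaterpillar ∧ Function.Injective φ ∧ ∀ e : G.E, T.IsLeaf (φ e)

/-- The caterpillar width of the cycle matroid `M(G)`. -/
def catWidth : ℕ :=
  sInf {k | ∃ (T : Multigraph) (φ : G.E → T.V), G.IsCatDecomp T φ ∧ G.branchWidthLE T φ k}

end Multigraph

/-! ### Concrete graphs -/

/-- The complete graph `K₅`. -/
def K5m : Multigraph where
  V := Fin 5
  E := {p : Fin 5 × Fin 5 // p.1 < p.2}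
  src := fun e => e.1.1
  tgt := fun e => e.1.2

/-- The complete bipartite graph `K₃,₃`. -/
def K33m : Multigraph where
  V := Fin 3 ⊕ Fin 3
  E := Fin 3 × Fin 3
  src := fun e => Sum.inl e.1
  tgt := fun e => Sum.inr e.2

/-- The cube (3-dimensional hypercube) graph `C`. -/
def cubeM : Multigraph where
  V := Fin 2 × Fin 2 × Fin 2
  E := Fin 3 × Fin 2 × Fin 2
  src := fun e =>
    if e.1 = 0 then (0, e.2.1, e.2.2) else if e.1 = 1 then (e.2.1, 0, e.2.2)
      else (e.2.1, e.2.2, 0)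
  tgt := fun e =>
    if e.1 = 0 then (1, e.2.1, e.2.2) else if e.1 = 1 then (e.2.1, 1, e.2.2)
      else (e.2.1, e.2.2, 1)

/-- The octahedron graph `O = K₂,₂,₂`. -/
def octaM : Multigraph where
  V := Fin 3 × Fin 2
  E := {p : (Fin 3 × Fin 2) × (Fin 3 × Fin 2) // p.1.1 < p.2.1}
  src := fun e => e.1.1
  tgt := fun e => e.1.2

/-- The edges of the graph `H` (the cube after a Y–Δ transformation at one
vertex): vertices `0,1,2` form the new triangle, `6` is the antipodal vertex. -/
def hEdgeList : List (Fin 7 × Fin 7) :=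
  [(0,1), (0,2), (1,2), (0,3), (0,4), (1,3), (1,5), (2,4), (2,5), (3,6), (4,6), (5,6)]

/-- The graph `H`, one Δ–Y away from each of the cube and the octahedron. -/
def Hm : Multigraph where
  V := Fin 7
  E := {p : Fin 7 × Fin 7 // p ∈ hEdgeList}
  src := fun e => e.1.1
  tgt := fun e => e.1.2

/-- The complete graph `K₄`. -/
def K4m : Multigraph where
  V := Fin 4
  E := {p : Fin 4 × Fin 4 // p.1 < p.2}
  src := fun e => e.1.1
  tgt := fun e => e.1.2

/-- `K₅⁻`, the complete graph on 5 vertices minus the edge `{3,4}`. -/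
def K5minusM : Multigraph where
  V := Fin 5
  E := {p : Fin 5 × Fin 5 // p.1 < p.2 ∧ ¬(p.1 = 3 ∧ p.2 = 4)}
  src := fun e => e.1.1
  tgt := fun e => e.1.2

/-- The wheel `W_k`: centre `none`; rim edges `Sum.inl i` join `some i` to
`some (i+1)`, spoke edges `Sum.inr i` join the centre to `some i`. -/
def wheelM (k : ℕ) : Multigraph where
  V := Option (Fin k)
  E := Fin k ⊕ Fin k
  src := Sum.elim (fun i => some i) (fun _ => none)
  tgt := Sum.elim (fun i => some (finRotate k i)) (fun i => some i)

/-! ### Enhanced graphs -/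

/-- An enhanced graph: a graph together with sets of contract-proof and
delete-proof edges. -/
structure EGraph : Type 1 where
  G : Multigraph
  Cp : Set G.E
  Dp : Set G.E

namespace EGraph

/-- The 5-configuration `S` of an enhanced graph splits. -/
def Splits (H : EGraph) (S : Set H.G.E) : Prop :=
  H.G.badSplitSep S ∨
    (∃ f ∈ S \ H.Dp, (H.G.minorDC {f} ∅).badSplitSep {e | e.1 ∈ S}) ∨
    (∃ f ∈ S \ H.Cp, (H.G.minorDC ∅ {f}).badSplitSep {e | e.1 ∈ S})

/-- An enhanced graph is non-split if it has a non-split 5-configuration. -/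
def NonSplit (H : EGraph) : Prop := ∃ S : Set H.G.E, S.ncard = 5 ∧ ¬ H.Splits S

/-- Deletion of an edge. -/
def delE (H : EGraph) (f : H.G.E) : EGraph :=
  ⟨H.G.minorDC {f} ∅, {e | e.1 ∈ H.Cp}, {e | e.1 ∈ H.Dp}⟩

/-- Contraction of an edge. -/
def conE (H : EGraph) (f : H.G.E) : EGraph :=
  ⟨H.G.minorDC ∅ {f}, {e | e.1 ∈ H.Cp}, {e | e.1 ∈ H.Dp}⟩

/-- Deletion of a vertex. -/
def delV (H : EGraph) (v : H.G.V) : EGraph :=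
  ⟨H.G.deleteVertex v, {e | e.1 ∈ H.Cp}, {e | e.1 ∈ H.Dp}⟩

/-- Remove an edge from the contract-proof set. -/
def unprotC (H : EGraph) (f : H.G.E) : EGraph := ⟨H.G, H.Cp \ {f}, H.Dp⟩

/-- Remove an edge from the delete-proof set. -/
def unprotD (H : EGraph) (f : H.G.E) : EGraph := ⟨H.G, H.Cp, H.Dp \ {f}⟩

/-- Delete `f'` of a parallel pair `f, f'` and make `f` delete-proof. -/
def parallelReduce (H : EGraph) (f f' : H.G.E) : EGraph :=
  ⟨H.G.minorDC {f'} ∅, {e | e.1 ∈ H.Cp}, {e | e.1 ∈ H.Dp ∨ e.1 = f}⟩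

/-- Contract `f'` of the two edges `f, f'` at a degree-two vertex and make
`f` contract-proof. -/
def seriesReduce (H : EGraph) (f f' : H.G.E) : EGraph :=
  ⟨H.G.minorDC ∅ {f'}, {e | e.1 ∈ H.Cp ∨ e.1 = f}, {e | e.1 ∈ H.Dp}⟩

/-- One step of the enhanced-graph minor relation. -/
inductive MinorStep : EGraph → EGraph → Prop
  | delV (H : EGraph) (v : H.G.V) : MinorStep H (H.delV v)
  | delE (H : EGraph) (f : H.G.E) : MinorStep H (H.delE f)
  | conE (H : EGraph) (f : H.G.E) : MinorStep H (H.conE f)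
  | unprotC (H : EGraph) (f : H.G.E) (hf : f ∈ H.Cp) : MinorStep H (H.unprotC f)
  | unprotD (H : EGraph) (f : H.G.E) (hf : f ∈ H.Dp) : MinorStep H (H.unprotD f)
  | parallel (H : EGraph) (f f' : H.G.E) (hne : f ≠ f')
      (hpar : H.G.ends f = H.G.ends f') : MinorStep H (H.parallelReduce f f')
  | series (H : EGraph) (f f' : H.G.E) (v : H.G.V) (hne : f ≠ f')
      (hf : H.G.inc v f) (hf' : H.G.inc v f')
      (hdeg : ∀ e : H.G.E, H.G.inc v e → e = f ∨ e = f') :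
      MinorStep H (H.seriesReduce f f')

/-- Minor-minimal non-split enhanced graph: non-split, but every proper
enhanced minor is split. -/
def MinorMinimalNonSplit (H : EGraph) : Prop :=
  H.NonSplit ∧ ∀ H' : EGraph, Relation.TransGen MinorStep H H' → ¬ H'.NonSplit

/-- Isomorphism of enhanced graphs. -/
def IsoTo (H H' : EGraph) : Prop :=
  ∃ (α : H.G.V ≃ H'.G.V) (β : H.G.E ≃ H'.G.E),
    (∀ e : H.G.E, H'.G.ends (β e) = Sym2.map α (H.G.ends e)) ∧
    (∀ e : H.G.E, β e ∈ H'.Cp ↔ e ∈ H.Cp) ∧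
    (∀ e : H.G.E, β e ∈ H'.Dp ↔ e ∈ H.Dp)

end EGraph

/-- The edge `01` of `K₄`. -/
def e01K4 : K4m.E := ⟨(0, 1), by decide⟩

/-- The enhanced graph `K₄(1)`: all edges of `K₄` except one are both
contract-proof and delete-proof. -/
def K4one : EGraph := ⟨K4m, {e | e ≠ e01K4}, {e | e ≠ e01K4}⟩

/-! ### The statement -/

open Multigraph

namespace Multigraph

variable (G : Multigraph)

/-- Whether some edge of the list `l` has an end whose label is `i`. -/
def touches (lbl : G.V → ℕ) (l : List G.E) (i : ℕ) : Bool :=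
  l.any fun e => (lbl (G.src e)).beq i || (lbl (G.tgt e)).beq i

/-- The number of labels below `n` that occur both on an end of an edge of `a` and on an
end of an edge of `b`. -/
def commonLabels (lbl : G.V → ℕ) (n : ℕ) (a b : List G.E) : ℕ :=
  (List.range n).countP fun i => G.touches lbl a i && G.touches lbl b i

/-- Search through all ways to distribute the edges of a list over the two sides `a` and `b`;
the answer is `true` if each of them leads to more than `k` common labels or to a side with
fewer than `c` edges. -/
def noSeparation (lbl : G.V → ℕ) (n k c : ℕ) : List G.E → List G.E → List G.E → Bool
  | [], a, b =>
    (k + 1).ble (G.commonLabels lbl n a b) || (a.length + 1).ble c || (b.length + 1).ble c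
  | e :: es, a, b =>
    (k + 1).ble (G.commonLabels lbl n a b) ||
      (noSeparation lbl n k c es (e :: a) b && noSeparation lbl n k c es a (e :: b))

variable {G}

lemma exists_inc_of_touches {lbl : G.V → ℕ} {l : List G.E} {i : ℕ}
    (h : G.touches lbl l i = true) : ∃ e ∈ l, ∃ v, G.inc v e ∧ lbl v = i := by
  simp only [touches, List.any_eq_true, Bool.or_eq_true, Nat.beq_eq] at h
  obtain ⟨e, he, h | h⟩ := h
  · exact ⟨e, he, _, Or.inl rfl, h⟩
  · exact ⟨e, he, _, Or.inr rfl, h⟩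

lemma commonLabels_le_sepOrder {lbl : G.V → ℕ} (hlbl : lbl.Injective) (n : ℕ)
    {a b : List G.E} {A : Set G.E} (ha : ∀ e ∈ a, e ∈ A) (hb : ∀ e ∈ b, e ∉ A) :
    G.commonLabels lbl n a b ≤ G.sepOrder A := by
  rw [commonLabels, List.countP_eq_length_filter,
    ← List.toFinset_card_of_nodup (List.nodup_range.filter _), ← Set.ncard_coe_finset, sepOrder]
  have hsub : ((((List.range n).filter fun i => G.touches lbl a i && G.touches lbl b i).toFinset :
      Finset ℕ) : Set ℕ) ⊆ lbl '' (G.edgeVerts A ∩ G.edgeVerts Aᶜ) := by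
    intro i hi
    simp only [List.coe_toFinset, List.mem_filter, Bool.and_eq_true, Set.mem_ofPred_eq] at hi
    obtain ⟨e, he, v, hv, rfl⟩ := exists_inc_of_touches hi.2.1
    obtain ⟨e', he', w, hw, hwv⟩ := exists_inc_of_touches hi.2.2
    exact ⟨v, ⟨⟨e, ha e he, hv⟩, ⟨e', hb e' he', hlbl hwv ▸ hw⟩⟩, rfl⟩
  exact (Set.ncard_le_ncard hsub (Set.toFinite _)).trans (Set.ncard_image_le (Set.toFinite _))

/-- A successful search starting from the sides `a ⊆ A` and `b ⊆ Aᶜ` shows that a separation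
`(A, Aᶜ)` of order at most `k` has a side with fewer than `c` edges. -/
lemma ncard_lt_of_noSeparation {lbl : G.V → ℕ} (hlbl : lbl.Injective) {n k c : ℕ}
    {A : Set G.E} (hA : G.sepOrder A ≤ k) {es a b : List G.E}
    (h : G.noSeparation lbl n k c es a b = true)
    (ha : ∀ e ∈ a, e ∈ A) (hb : ∀ e ∈ b, e ∉ A) (hes : ∀ e, e ∈ es ∨ e ∈ a ∨ e ∈ b) :
    A.ncard < c ∨ Aᶜ.ncard < c := by
  have hk := (commonLabels_le_sepOrder hlbl n ha hb).trans hA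
  induction es generalizing a b with
  | nil =>
    simp only [noSeparation, Bool.or_eq_true, Nat.ble_eq] at h
    have hlen : ∀ {l : List G.E} {S : Set G.E}, S ⊆ {e | e ∈ l} → S.ncard ≤ l.length := by
      intro l S hS
      rw [← List.coe_toFinset] at hS
      exact (Set.ncard_le_ncard hS (Finset.finite_toSet _)).trans
        ((Set.ncard_coe_finset _).trans_le (List.toFinset_card_le l))
    have hAa : A.ncard ≤ a.length := hlen fun e he => by
      rcases hes e with h | h | h
      · simp at h
      · exact h
      · exact absurd he (hb e h)
    have hAb : Aᶜ.ncard ≤ b.length := hlen fun e he => by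
      rcases hes e with h | h | h
      · simp at h
      · exact absurd (ha e h) he
      · exact h
    omega
  | cons e es ih =>
    simp only [noSeparation, Bool.or_eq_true, Bool.and_eq_true, Nat.ble_eq] at h
    obtain ⟨h₁, h₂⟩ := h.resolve_left (by omega)
    by_cases he : e ∈ A
    · have ha' : ∀ x ∈ e :: a, x ∈ A := List.forall_mem_cons.2 ⟨he, ha⟩
      refine ih h₁ ha' hb (fun x => ?_) ((commonLabels_le_sepOrder hlbl n ha' hb).trans hA)
      have := hes x
      simp only [List.mem_cons] at this ⊢
      tauto
    · have hb' : ∀ x ∈ e :: b, x ∉ A := List.forall_mem_cons.2 ⟨he, hb⟩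
      refine ih h₂ ha hb' (fun x => ?_) ((commonLabels_le_sepOrder hlbl n ha hb').trans hA)
      have := hes x
      simp only [List.mem_cons] at this ⊢
      tauto

lemma not_le_ncard_of_noSeparation {lbl : G.V → ℕ} (hlbl : lbl.Injective) {n k c : ℕ}
    {es : List G.E} (hes : ∀ e, e ∈ es) (h : G.noSeparation lbl n k c es [] [] = true) (A : Set G.E)
    (hA : G.sepOrder A ≤ k) : ¬ (c ≤ A.ncard ∧ c ≤ Aᶜ.ncard) := by
  have := ncard_lt_of_noSeparation hlbl hA h (by simp) (by simp) fun e => Or.inl (hes e)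
  omega

/-- An edge ordering of width at most `k` contains a separation of order at most `k` whose first
side has a prescribed number `c` of edges. -/
lemma not_widthLE_of_forall_sepOrder {k c : ℕ} (hc : 2 * c ≤ Fintype.card G.E)
    (h : ∀ A : Set G.E, G.sepOrder A ≤ k → ¬ (c ≤ A.ncard ∧ c ≤ Aᶜ.ncard)) :
    ¬ G.WidthLE k := by
  rintro ⟨f, hf⟩
  have hcard : {e | ∃ i : Fin (Fintype.card G.E), f i = e ∧ (i : ℕ) < c}.ncard = c := by
    have himage : {e | ∃ i : Fin (Fintype.card G.E), f i = e ∧ (i : ℕ) < c} =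
        f '' ((Finset.univ.filter fun i : Fin (Fintype.card G.E) => (i : ℕ) < c) :
          Finset _) := by
      ext e
      simp only [Finset.coe_filter, Finset.mem_univ, true_and, Set.mem_image, Set.mem_ofPred_eq,
        and_comm]
    rw [himage, Set.ncard_image_of_injective _ f.injective, Set.ncard_coe_finset,
      Fin.card_filter_val_lt]
    omega
  refine h _ (hf c) ⟨hcard.ge, ?_⟩
  rw [Set.ncard_compl, hcard, Nat.card_eq_fintype_card]
  omega

end Multigraph

/-- The members of a list that satisfy `p`, as elements of the subtype. -/
def listSubtype {α : Type*} (p : α → Prop) [DecidablePred p] (l : List α) : List {a // p a} :=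
  l.filterMap fun a => if h : p a then some ⟨a, h⟩ else none

lemma mem_listSubtype {α : Type*} {p : α → Prop} [DecidablePred p] {l : List α}
    (hl : ∀ a, a ∈ l) (a : {a // p a}) : a ∈ listSubtype p l :=
  List.mem_filterMap.2 ⟨a.1, hl _, by simp [a.2]⟩

lemma K33m_not_le_ncard (A : Set K33m.E) (hA : K33m.sepOrder A ≤ 3) :
    ¬ (4 ≤ A.ncard ∧ 4 ≤ Aᶜ.ncard) :=
  not_le_ncard_of_noSeparation (G := K33m) (lbl := Sum.elim Fin.val (3 + Fin.val ·))
    (Sum.elim_injective.2 ⟨Fin.val_injective, (add_right_injective 3).comp Fin.val_injective,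
      fun i j => by omega⟩) (n := 6)
    (es := List.finRange 3 ×ˢ List.finRange 3)
    (fun _ => List.mem_product.2 ⟨List.mem_finRange _, List.mem_finRange _⟩)
    (by decide +kernel) A hA

lemma K5m_not_le_ncard (A : Set K5m.E) (hA : K5m.sepOrder A ≤ 3) :
    ¬ (4 ≤ A.ncard ∧ 4 ≤ Aᶜ.ncard) :=
  not_le_ncard_of_noSeparation (G := K5m) Fin.val_injective (n := 5)
    (es := listSubtype _ (List.finRange 5 ×ˢ List.finRange 5))
    (mem_listSubtype (by decide)) (by decide +kernel) A hA

lemma cubeM_not_le_ncard (A : Set cubeM.E) (hA : cubeM.sepOrder A ≤ 3) :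
    ¬ (4 ≤ A.ncard ∧ 4 ≤ Aᶜ.ncard) :=
  not_le_ncard_of_noSeparation (G := cubeM)
    (lbl := fun v => 4 * v.1.val + 2 * v.2.1.val + v.2.2.val)
    (fun (v w : Fin 2 × Fin 2 × Fin 2) h => by
      dsimp only at h
      refine Prod.ext (Fin.ext ?_) (Prod.ext (Fin.ext ?_) (Fin.ext ?_)) <;> omega) (n := 8)
    (es := List.finRange 3 ×ˢ List.finRange 2 ×ˢ List.finRange 2)
    (fun _ => List.mem_product.2
      ⟨List.mem_finRange _, List.mem_product.2 ⟨List.mem_finRange _, List.mem_finRange _⟩⟩)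
    (by decide +kernel) A hA

lemma octaM_not_le_ncard (A : Set octaM.E) (hA : octaM.sepOrder A ≤ 3) :
    ¬ (4 ≤ A.ncard ∧ 4 ≤ Aᶜ.ncard) :=
  not_le_ncard_of_noSeparation (G := octaM) (lbl := fun v => 2 * v.1.val + v.2.val)
    (fun (v w : Fin 3 × Fin 2) h => by
      dsimp only at h
      refine Prod.ext (Fin.ext ?_) (Fin.ext ?_) <;> omega) (n := 6)
    (es := listSubtype _ ((List.finRange 3 ×ˢ List.finRange 2) ×ˢ
      (List.finRange 3 ×ˢ List.finRange 2)))
    (mem_listSubtype (by decide)) (by decide +kernel) A hA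

lemma Hm_not_le_ncard (A : Set Hm.E) (hA : Hm.sepOrder A ≤ 3) :
    ¬ (5 ≤ A.ncard ∧ 5 ≤ Aᶜ.ncard) :=
  not_le_ncard_of_noSeparation (G := Hm) Fin.val_injective (n := 7)
    (es := hEdgeList.attach) (List.mem_attach _) (by decide +kernel) A hA

theorem stmt2 :
    (¬ K33m.WidthLE 3 ∧ ¬ K5m.WidthLE 3 ∧ ¬ cubeM.WidthLE 3 ∧
      ¬ octaM.WidthLE 3 ∧ ¬ Hm.WidthLE 3) ∧
    (∀ G ∈ [K33m, K5m, cubeM, octaM], ∀ A : Set G.E,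
      G.sepOrder A ≤ 3 → ¬ (4 ≤ A.ncard ∧ 4 ≤ Aᶜ.ncard)) ∧
    (∀ A : Set Hm.E, Hm.sepOrder A ≤ 3 → ¬ (5 ≤ A.ncard ∧ 5 ≤ Aᶜ.ncard)) := by
  refine ⟨⟨not_widthLE_of_forall_sepOrder (by decide) K33m_not_le_ncard,
    not_widthLE_of_forall_sepOrder (by decide) K5m_not_le_ncard,
    not_widthLE_of_forall_sepOrder (by decide) cubeM_not_le_ncard,
    not_widthLE_of_forall_sepOrder (by decide) octaM_not_le_ncard,
    not_widthLE_of_forall_sepOrder (by decide) Hm_not_le_ncard⟩, ?_, Hm_not_le_ncard⟩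
  simp only [List.forall_mem_cons]
  exact ⟨K33m_not_le_ncard, K5m_not_le_ncard, cubeM_not_le_ncard, octaM_not_le_ncard, by simp⟩
end
end

section
/- If a connected graph G is Feynman 5-split, then every connected graph obtained from G by deleting and contracting edges is also Feynman 5-split; that is, Feynman 5-splitting is a minor-closed property. -/
/-!  Common definitions: multigraphs, separations, width, minors,
Kirchhoff/Dodgson polynomials, Feynman 5-splitting, enhanced graphs. -/

noncomputable section

attribute [local instance] Classical.propDecidable

/-! ### The statement -/

open Multigraph

namespace Multigraph

/-- The entry of the oriented incidence matrix at the edge `e` and the vertex `v`. -/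
def incidence (R : Type*) [CommRing R] (G : Multigraph) (e : G.E) (v : G.V) : R :=
  (if G.src e = v then 1 else 0) - (if G.tgt e = v then 1 else 0)

/-- The matrix whose determinant is a Dodgson polynomial, with the row of each edge `e`
homogenized: `y e` replaces the variable of `e`, and the incidence vector of `e` is scaled
by `z e`. -/
def homogMatrix {R : Type*} [CommRing R] (G : Multigraph) (v0 : G.V) {I J : Set G.E}
    (σ : {e : G.E // e ∉ I} ≃ {e : G.E // e ∉ J}) (y z : G.E → R) :
    Matrix ({e : G.E // e ∉ I} ⊕ {v : G.V // v ≠ v0})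
      ({e : G.E // e ∉ I} ⊕ {v : G.V // v ≠ v0}) R :=
  Matrix.of fun r c =>
    match r, c with
    | Sum.inl e, Sum.inl f => if e.1 = (σ f).1 then y e.1 else 0
    | Sum.inl e, Sum.inr v => z e.1 * G.incidence R e.1 v.1
    | Sum.inr v, Sum.inl f => - G.incidence R (σ f).1 v.1
    | Sum.inr _, Sum.inr _ => 0

/-- `α` is a flow: it is orthogonal to all potential differences. -/
def IsFlow (G : Multigraph) (α : G.E → ℚ) : Prop :=
  ∀ q : G.V → ℚ, ∑ e, α e * (q (G.src e) - q (G.tgt e)) = 0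

/-- The only solutions of the system consisting of a flow `α` vanishing on `J` and a
potential `p` with `y e * α e + z e * δp e = 0` for `e ∉ I` are `α = 0` and `p` constant. -/
def IsRegular (G : Multigraph) (I J : Set G.E) (y z : G.E → ℚ) : Prop :=
  ∀ (α : G.E → ℚ) (p : G.V → ℚ), (∀ e ∈ J, α e = 0) → G.IsFlow α →
    (∀ e, e ∉ I → y e * α e + z e * (p (G.src e) - p (G.tgt e)) = 0) →
    (∀ e, α e = 0) ∧ ∀ u v, p u = p v

variable (G : Multigraph)

lemma sum_incidence_mul (e : G.E) (q : G.V → ℚ) :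
    ∑ v, G.incidence ℚ e v * q v = q (G.src e) - q (G.tgt e) := by
  simp [incidence, sub_mul, Finset.sum_sub_distrib]

lemma sum_incidence_mul_of_root (v0 : G.V) (e : G.E) (q : G.V → ℚ) (hq : q v0 = 0) :
    ∑ v : {v : G.V // v ≠ v0}, G.incidence ℚ e v.1 * q v.1 = q (G.src e) - q (G.tgt e) := by
  rw [← G.sum_incidence_mul e q]
  refine Fintype.sum_of_injective Subtype.val Subtype.val_injective _ _ ?_ fun _ => rfl
  intro v hv
  have : v = v0 := by simpa using hv
  simp [this, hq]

lemma homogMatrix_mulVec_inl (v0 : G.V) {I J : Set G.E}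
    (σ : {e : G.E // e ∉ I} ≃ {e : G.E // e ∉ J}) (y z : G.E → ℚ)
    (α : G.E → ℚ) (p : G.V → ℚ) (hα : ∀ e ∈ J, α e = 0) (hp : p v0 = 0)
    (e : {e : G.E // e ∉ I}) :
    (G.homogMatrix v0 σ y z).mulVec (Sum.elim (fun f => α (σ f).1) fun v => p v.1) (Sum.inl e)
      = y e.1 * α e.1 + z e.1 * (p (G.src e.1) - p (G.tgt e.1)) := by
  rw [← G.sum_incidence_mul_of_root v0 e.1 p hp]
  simp only [Matrix.mulVec, dotProduct, homogMatrix, Matrix.of_apply, Fintype.sum_sum_type,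
    Sum.elim_inl, Sum.elim_inr, Finset.mul_sum, mul_assoc]
  congr 1
  rw [Fintype.sum_equiv σ _
    (fun f : {e : G.E // e ∉ J} => (if e.1 = f.1 then y e.1 else 0) * α f.1) fun _ => rfl,
    Fintype.sum_of_injective Subtype.val Subtype.val_injective _
      (fun f => (if e.1 = f then y e.1 else 0) * α f) _ fun _ => rfl]
  · simp
  · intro f hf
    have : f ∈ J := by simpa using hf
    simp [hα f this]

lemma homogMatrix_mulVec_inr (v0 : G.V) {I J : Set G.E}
    (σ : {e : G.E // e ∉ I} ≃ {e : G.E // e ∉ J}) (y z : G.E → ℚ)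
    (α : G.E → ℚ) (p : G.V → ℚ) (hα : ∀ e ∈ J, α e = 0) (v : {v : G.V // v ≠ v0}) :
    (G.homogMatrix v0 σ y z).mulVec (Sum.elim (fun f => α (σ f).1) fun v => p v.1) (Sum.inr v)
      = - ∑ e, α e * G.incidence ℚ e v.1 := by
  simp only [Matrix.mulVec, dotProduct, homogMatrix, Matrix.of_apply, Fintype.sum_sum_type,
    Sum.elim_inl, Sum.elim_inr, zero_mul, Finset.sum_const_zero, add_zero,
    ← Finset.sum_neg_distrib]
  rw [Fintype.sum_equiv σ _
    (fun f : {e : G.E // e ∉ J} => - G.incidence ℚ f.1 v.1 * α f.1) fun _ => rfl]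
  refine Fintype.sum_of_injective Subtype.val Subtype.val_injective _ _ ?_ fun _ => by ring
  intro f hf
  have : f ∈ J := by simpa using hf
  simp [hα f this]

lemma isFlow_of_forall_ne (v0 : G.V) (α : G.E → ℚ)
    (h : ∀ v, v ≠ v0 → ∑ e, α e * G.incidence ℚ e v = 0) : G.IsFlow α := by
  intro q
  calc ∑ e, α e * (q (G.src e) - q (G.tgt e))
      = ∑ e, α e * ∑ v, G.incidence ℚ e v * (q v - q v0) := by
        refine Finset.sum_congr rfl fun e _ => ?_
        rw [G.sum_incidence_mul e fun v => q v - q v0]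
        ring
    _ = ∑ v, (∑ e, α e * G.incidence ℚ e v) * (q v - q v0) := by
        simp only [Finset.mul_sum, Finset.sum_mul, mul_assoc]
        exact Finset.sum_comm
    _ = 0 := by
        refine Finset.sum_eq_zero fun v _ => ?_
        by_cases hv : v = v0
        · simp [hv]
        · rw [h v hv, zero_mul]

lemma IsFlow.sum_incidence {G : Multigraph} {α : G.E → ℚ} (h : G.IsFlow α) (v : G.V) :
    ∑ e, α e * G.incidence ℚ e v = 0 := by
  rw [← h fun w => if w = v then 1 else 0]
  rfl

lemma det_homogMatrix_ne_zero_iff (v0 : G.V) {I J : Set G.E}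
    (σ : {e : G.E // e ∉ I} ≃ {e : G.E // e ∉ J}) (y z : G.E → ℚ) :
    (G.homogMatrix v0 σ y z).det ≠ 0 ↔ G.IsRegular I J y z := by
  rw [Ne, ← Matrix.exists_mulVec_eq_zero_iff]
  constructor
  · intro hdet α p hα hflow hp
    have hzero : Sum.elim (fun f => α (σ f).1) (fun v : {v // v ≠ v0} => p v.1 - p v0) = 0 := by
      by_contra hne
      refine hdet ⟨_, hne, ?_⟩
      funext r
      rcases r with e | v
      · rw [G.homogMatrix_mulVec_inl v0 σ y z α (fun v => p v - p v0) hα (sub_self _)]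
        simpa using hp e.1 e.2
      · rw [G.homogMatrix_mulVec_inr v0 σ y z α (fun v => p v - p v0) hα, hflow.sum_incidence]
        simp
    have hp0 : ∀ v, p v = p v0 := by
      intro v
      by_cases hv : v = v0
      · rw [hv]
      · exact sub_eq_zero.1 (congrFun hzero (Sum.inr ⟨v, hv⟩))
    refine ⟨fun e => ?_, fun u v => (hp0 u).trans (hp0 v).symm⟩
    by_cases he : e ∈ J
    · exact hα e he
    · simpa using congrFun hzero (Sum.inl (σ.symm ⟨e, he⟩))
  · rintro hreg ⟨w, hw, hker⟩
    let α : G.E → ℚ := fun e => if h : e ∉ J then w (Sum.inl (σ.symm ⟨e, h⟩)) else 0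
    let p : G.V → ℚ := fun v => if h : v ≠ v0 then w (Sum.inr ⟨v, h⟩) else 0
    have hα : ∀ e ∈ J, α e = 0 := fun e he => by simp [α, he]
    have hp : p v0 = 0 := by simp [p]
    have hwe : w = Sum.elim (fun f => α (σ f).1) fun v => p v.1 := by
      funext r
      rcases r with f | v
      · simp [α, (σ f).2]
      · simp [p, v.2]
    rw [hwe] at hker
    obtain ⟨h1, h2⟩ := hreg α p hα
      (G.isFlow_of_forall_ne v0 α fun v hv => by
        have := congrFun hker (Sum.inr ⟨v, hv⟩)
        rw [G.homogMatrix_mulVec_inr v0 σ y z α p hα] at this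
        simpa using this)
      (fun e he => by
        rw [← G.homogMatrix_mulVec_inl v0 σ y z α p hα hp ⟨e, he⟩, hker]
        rfl)
    refine hw (hwe.trans ?_)
    funext r
    rcases r with f | v
    · exact h1 _
    · exact (h2 _ v0).trans hp

lemma incCol_eq_incidence (e : G.E) (v : G.V) :
    G.incCol e v = G.incidence (MvPolynomial G.E ℤ) e v := rfl

lemma map_incidence {R S F : Type*} [CommRing R] [CommRing S] [FunLike F R S]
    [RingHomClass F R S] (φ : F) (e : G.E) (v : G.V) :
    φ (G.incidence R e v) = G.incidence S e v := by
  simp only [incidence, map_sub]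
  split_ifs <;> simp

lemma aeval_dodgson (v0 : G.V) {I J : Set G.E} (K : Set G.E)
    (h : Nonempty ({e : G.E // e ∉ I} ≃ {e : G.E // e ∉ J})) (x : G.E → ℚ) :
    MvPolynomial.aeval x (G.dodgson v0 I J K)
      = (G.homogMatrix v0 h.some (fun e => if e ∈ K then 0 else x e) 1).det := by
  rw [dodgson, dif_pos h, AlgHom.map_det, AlgHom.map_det]
  congr 1
  ext r c
  rcases r with e | v <;> rcases c with f | w
  · by_cases hef : e.1 = (h.some f).1
    · by_cases hK : (h.some f).1 ∈ K <;>
        simp [bigMatrix, homogMatrix, hef, hK]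
    · simp [bigMatrix, homogMatrix, hef]
  · simp [bigMatrix, homogMatrix, incCol_eq_incidence, map_incidence]
  · simp [bigMatrix, homogMatrix, incCol_eq_incidence, map_incidence]
  · simp [bigMatrix, homogMatrix]

lemma dodgson_ne_zero_iff (v0 : G.V) {I J : Set G.E} (K : Set G.E)
    (h : Nonempty ({e : G.E // e ∉ I} ≃ {e : G.E // e ∉ J})) :
    G.dodgson v0 I J K ≠ 0 ↔
      ∃ x : G.E → ℚ, G.IsRegular I J (fun e => if e ∈ K then 0 else x e) 1 := by
  constructor
  · intro hne
    by_contra! hx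
    refine hne (MvPolynomial.map_injective (Int.castRingHom ℚ) Int.cast_injective ?_)
    rw [map_zero]
    refine MvPolynomial.funext fun x => ?_
    rw [MvPolynomial.eval_map, map_zero]
    by_contra hxne
    refine hx x ((G.det_homogMatrix_ne_zero_iff v0 h.some _ _).1 ?_)
    rw [← G.aeval_dodgson v0 K h x]
    exact hxne
  · rintro ⟨x, hx⟩ hzero
    refine (G.det_homogMatrix_ne_zero_iff v0 h.some _ _).2 hx ?_
    rw [← G.aeval_dodgson v0 K h x, hzero, map_zero]

/-- If the homogenized system is regular at the parameter `t = 0` of the line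
`z = z₀ + z₁ * t`, then it is regular at some nonzero parameter. -/
lemma IsRegular.exists_ne_zero {G : Multigraph} {I J : Set G.E} (v0 : G.V)
    (σ : {e : G.E // e ∉ I} ≃ {e : G.E // e ∉ J}) {y z₀ z₁ : G.E → ℚ}
    (h : G.IsRegular I J y z₀) :
    ∃ t : ℚ, t ≠ 0 ∧ G.IsRegular I J y fun e => z₀ e + z₁ e * t := by
  let P : Polynomial ℚ := (G.homogMatrix v0 σ (fun e => Polynomial.C (y e))
    fun e => Polynomial.C (z₀ e) + Polynomial.C (z₁ e) * Polynomial.X).det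
  have heval : ∀ t, P.eval t = (G.homogMatrix v0 σ y fun e => z₀ e + z₁ e * t).det := by
    intro t
    rw [← Polynomial.coe_evalRingHom, RingHom.map_det]
    congr 1
    ext r c
    rcases r with e | v <;> rcases c with f | w <;>
      simp [homogMatrix, incidence, apply_ite (Polynomial.eval t)]
  have hP : P ≠ 0 := by
    intro hP
    have h0 := (G.det_homogMatrix_ne_zero_iff v0 σ y z₀).2 h
    have := heval 0
    simp only [mul_zero, add_zero, hP, Polynomial.eval_zero] at this
    exact h0 this.symm
  have hXP : Polynomial.X * P ≠ 0 := mul_ne_zero Polynomial.X_ne_zero hP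
  obtain ⟨t, ht⟩ : ∃ t : ℚ, (Polynomial.X * P).eval t ≠ 0 := by
    by_contra! hall
    exact hXP (Polynomial.funext fun t => by simpa using hall t)
  rw [Polynomial.eval_mul, Polynomial.eval_X] at ht
  refine ⟨t, left_ne_zero_of_mul ht, (G.det_homogMatrix_ne_zero_iff v0 σ _ _).1 ?_⟩
  rw [← heval]
  exact right_ne_zero_of_mul ht

lemma IsRegular.div {G : Multigraph} {I J : Set G.E} {y z : G.E → ℚ}
    (h : G.IsRegular I J y z) (hz : ∀ e, z e ≠ 0) :
    G.IsRegular I J (fun e => y e / z e) 1 := by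
  intro α p hα hflow hp
  refine h α p hα hflow fun e he => ?_
  have := congrArg (z e * ·) (hp e he)
  simp only [Pi.one_apply, mul_zero] at this
  rw [← this]
  field_simp [hz e]

/-- The potential difference along an edge, as a linear functional on potentials. -/
def potentialDiff (e : G.E) : (G.V → ℚ) →ₗ[ℚ] ℚ :=
  LinearMap.proj (R := ℚ) (φ := fun _ => ℚ) (G.src e) - LinearMap.proj (G.tgt e)

/-- Every edge set contains a subset supporting no nonzero flow and such that a potential
that is constant along the subset is constant along the whole set. -/
lemma exists_flowFree_subset (C : Set G.E) :
    ∃ B ⊆ C, (∀ α : G.E → ℚ, G.IsFlow α → (∀ e, e ∉ B → α e = 0) → ∀ e, α e = 0) ∧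
      ∀ p : G.V → ℚ, (∀ e ∈ B, p (G.src e) = p (G.tgt e)) →
        ∀ e ∈ C, p (G.src e) = p (G.tgt e) := by
  obtain ⟨B, hBC, -, hspan, hind⟩ := exists_linearIndepOn_extension
    (K := ℚ) (v := G.potentialDiff) (linearIndepOn_empty ℚ _) (Set.empty_subset C)
  refine ⟨B, hBC, fun α hflow hsupp e => ?_, fun p hp e he => ?_⟩
  · by_cases he : e ∈ B
    · refine (Fintype.linearIndependent_iff.1 hind (fun b => α b.1) ?_) ⟨e, he⟩
      refine LinearMap.ext fun q => ?_
      rw [Fintype.sum_of_injective Subtype.val Subtype.val_injective _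
        (fun e => α e • G.potentialDiff e) (fun f hf => ?_) fun _ => rfl]
      · simpa [potentialDiff] using hflow q
      · rw [hsupp f (by simpa using hf), zero_smul]
    · exact hsupp e he
  · have hle : Submodule.span ℚ (G.potentialDiff '' B)
        ≤ LinearMap.ker (LinearMap.applyₗ (R := ℚ) (M₂ := ℚ) p) := by
      rw [Submodule.span_le]
      rintro _ ⟨b, hb, rfl⟩
      simp [potentialDiff, hp b hb]
    have := hle (hspan ⟨e, he, rfl⟩)
    simpa [potentialDiff, sub_eq_zero] using this

/-- Regularity of a minor lifts: take `α e = 0` as the equation of the deleted edges and of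
the contracted edges outside `B`, and a vanishing potential difference as that of `B`. -/
lemma isRegular_of_minorDC {D C B : Set G.E} (hBC : B ⊆ C)
    (hfree : ∀ α : G.E → ℚ, G.IsFlow α → (∀ e, e ∉ B → α e = 0) → ∀ e, α e = 0)
    (hpot : ∀ p : G.V → ℚ, (∀ e ∈ B, p (G.src e) = p (G.tgt e)) →
      ∀ e ∈ C, p (G.src e) = p (G.tgt e))
    {I J : Set G.E} (hI : ∀ e ∈ I, e ∉ D ∪ C) {y z : G.E → ℚ}
    (hyB : ∀ e ∈ B, y e = 0) (hzB : ∀ e ∈ B, z e = 1)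
    (hy : ∀ e ∈ (D ∪ C) \ B, y e = 1) (hz : ∀ e ∈ (D ∪ C) \ B, z e = 0)
    (hreg : (G.minorDC D C).IsRegular {e | e.1 ∈ I} {e | e.1 ∈ J}
      (fun e => y e.1) fun e => z e.1) :
    G.IsRegular I J y z := by
  intro α p hα hflow hp
  have hα0 : ∀ e ∈ (D ∪ C) \ B, α e = 0 := by
    intro e he
    have := hp e fun heI => hI e heI he.1
    simpa [hy e he, hz e he] using this
  have hpB : ∀ e ∈ B, p (G.src e) = p (G.tgt e) := by
    intro e he
    have := hp e fun heI => hI e heI (Or.inr (hBC he))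
    simpa [hyB e he, hzB e he, sub_eq_zero] using this
  let p' : (G.minorDC D C).V → ℚ := Quot.lift p (by
    rintro a b ⟨e, he, rfl, rfl⟩
    exact hpot p hpB e he)
  obtain ⟨h1, h2⟩ := hreg (fun e => α e.1) p' (fun e he => hα e.1 he) (by
    intro q
    rw [← hflow fun v => q (Quot.mk _ v)]
    refine Fintype.sum_of_injective (ι := (G.minorDC D C).E) Subtype.val
      Subtype.val_injective _ _ (fun e he => ?_) fun _ => rfl
    have he : e ∈ D ∪ C := by
      by_contra hne
      exact he ⟨⟨e, hne⟩, rfl⟩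
    by_cases heB : e ∈ B
    · have : (Quot.mk _ (G.src e) : (G.minorDC D C).V) = Quot.mk _ (G.tgt e) :=
        Quot.sound ⟨e, hBC heB, rfl, rfl⟩
      rw [this, sub_self, mul_zero]
    · rw [hα0 e ⟨he, heB⟩, zero_mul]) (fun e he => hp e.1 he)
  refine ⟨hfree α hflow fun e he => ?_, fun u v => h2 (Quot.mk _ u) (Quot.mk _ v)⟩
  by_cases heDC : e ∈ D ∪ C
  · exact hα0 e ⟨heDC, he⟩
  · exact h1 ⟨e, heDC⟩

/-- A vanishing Dodgson polynomial of `G` stays zero in every minor of `G`. -/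
lemma dodgson_minorDC_eq_zero {D C I J K : Set G.E} (hI : ∀ e ∈ I, e ∉ D ∪ C)
    (hK : ∀ e ∈ K, e ∉ D ∪ C) (hIJ : I.ncard = J.ncard)
    (hzero : ∀ v0, G.dodgson v0 I J K = 0) (w0 : (G.minorDC D C).V) :
    (G.minorDC D C).dodgson w0 {e | e.1 ∈ I} {e | e.1 ∈ J} {e | e.1 ∈ K} = 0 := by
  by_contra hne
  have h' : Nonempty ({e : (G.minorDC D C).E // e ∉ {e | e.1 ∈ I}} ≃
      {e : (G.minorDC D C).E // e ∉ {e | e.1 ∈ J}}) := by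
    by_contra h'
    exact hne (by rw [dodgson, dif_neg h'])
  have h : Nonempty ({e : G.E // e ∉ I} ≃ {e : G.E // e ∉ J}) := by
    have hcard : Nat.card ((Iᶜ : Set G.E) : Type) = Nat.card ((Jᶜ : Set G.E) : Type) := by
      have hIc := Set.ncard_add_ncard_compl I
      have hJc := Set.ncard_add_ncard_compl J
      rw [Nat.card_coe_set_eq, Nat.card_coe_set_eq]
      omega
    exact Finite.card_eq.1 hcard
  obtain ⟨x, hx⟩ := ((G.minorDC D C).dodgson_ne_zero_iff w0 _ h').1 hne
  obtain ⟨v0, -⟩ := Quot.exists_rep w0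
  obtain ⟨B, hBC, hfree, hpot⟩ := G.exists_flowFree_subset C
  let y : G.E → ℚ := fun e =>
    if he : e ∉ D ∪ C then (if e ∈ K then 0 else x ⟨e, he⟩) else if e ∈ B then 0 else 1
  let z₁ : G.E → ℚ := fun e => if e ∈ (D ∪ C) \ B then 1 else 0
  have hBDC : ∀ e ∈ B, e ∈ D ∪ C := fun e he => Or.inr (hBC he)
  have hreg : G.IsRegular I J y fun e => 1 - z₁ e := by
    refine G.isRegular_of_minorDC hBC hfree hpot hI (fun e he => ?_) (fun e he => ?_)
      (fun e he => ?_) (fun e he => ?_) ?_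
    · simp only [y, dif_neg (not_not.2 (hBDC e he)), if_pos he]
    · simp [z₁, he]
    · simp only [y, dif_neg (not_not.2 he.1), if_neg he.2]
    · simp only [z₁, if_pos he, sub_self]
    · convert hx using 1
      · funext e
        simp only [y, dif_pos e.2]
        rfl
      · funext e
        simp only [z₁, if_neg fun he : e.1 ∈ (D ∪ C) \ B => e.2 he.1, sub_zero]
        rfl
  obtain ⟨t, ht, hregt⟩ := hreg.exists_ne_zero v0 h.some (z₁ := z₁)
  have hzt : ∀ e, 1 - z₁ e + z₁ e * t ≠ 0 := by
    intro e
    by_cases he : e ∈ (D ∪ C) \ B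
    · simpa only [z₁, if_pos he, sub_self, zero_add, one_mul] using ht
    · simp only [z₁, if_neg he]
      norm_num
  refine (G.dodgson_ne_zero_iff v0 K h).2 ⟨fun e => y e / (1 - z₁ e + z₁ e * t), ?_⟩ (hzero v0)
  convert hregt.div hzt using 2 with e
  by_cases he : e ∈ K
  · simp only [y, dif_pos (hK e he), if_pos he, zero_div]
  · rw [if_neg he]

end Multigraph

theorem stmt5 (G : Multigraph) (hG : G.Connected) (hsplit : G.FeynmanSplit)
    (D C : Set G.E) (hDC : Disjoint D C) (hconn : (G.minorDC D C).Connected) :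
    (G.minorDC D C).FeynmanSplit := by
  intro S hS
  let ι : (G.minorDC D C).E → G.E := Subtype.val
  have hι : Function.Injective ι := Subtype.val_injective
  obtain ⟨I, J, K, ⟨hU, hcase⟩, hzero⟩ :=
    hsplit (ι '' S) ((Set.ncard_image_of_injective S hι).trans hS)
  have hrange : I ∪ J ∪ K ⊆ Set.range ι := hU ▸ Set.image_subset_range ι S
  have hcard : ∀ A ⊆ I ∪ J ∪ K, (ι ⁻¹' A).ncard = A.ncard := fun A hA =>
    Set.ncard_preimage_of_injective_subset_range hι (hA.trans hrange)
  have hIs : I ⊆ I ∪ J ∪ K := fun _ h => Or.inl (Or.inl h)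
  have hJs : J ⊆ I ∪ J ∪ K := fun _ h => Or.inl (Or.inr h)
  have hKs : K ⊆ I ∪ J ∪ K := fun _ h => Or.inr h
  have hnot : ∀ A ⊆ I ∪ J ∪ K, ∀ e ∈ A, e ∉ D ∪ C := by
    intro A hA e he
    obtain ⟨e', rfl⟩ := hrange (hA he)
    exact e'.2
  refine ⟨ι ⁻¹' I, ι ⁻¹' J, ι ⁻¹' K, ⟨?_, ?_⟩,
    G.dodgson_minorDC_eq_zero (hnot I hIs) (hnot K hKs) ?_ hzero⟩
  · rw [← Set.preimage_union, ← Set.preimage_union, hU, Set.preimage_image_eq S hι]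
  · simp only [← Set.preimage_inter, hcard I hIs, hcard J hJs, hcard K hKs,
      hcard (I ∩ J) (Set.inter_subset_left.trans hIs)]
    rcases hcase with ⟨h1, h2, h3, h4, h5, h6⟩ | ⟨h1, h2, h3, h4⟩
    · exact Or.inl ⟨h1, h2, h3, by simp [h4], by simp [h5], by simp [h6]⟩
    · exact Or.inr ⟨h1, h2, by simp [h3], h4⟩
  · rcases hcase with ⟨h1, h2, -⟩ | ⟨h1, h2, -⟩ <;> rw [h1, h2]
end
end

section
/- Let G and G* be connected graphs on the same edge set E such that a subset T ⊆ E is the edge set of a spanning tree of G if and only if E ∖ T is the edge set of a spanning tree of G* (this is the defining property of a planar dual pair). Then G is Feynman 5-split if and only if G* is Feynman 5-split. -/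
/-!  Common definitions: multigraphs, separations, width, minors,
Kirchhoff/Dodgson polynomials, Feynman 5-splitting, enhanced graphs. -/

noncomputable section

attribute [local instance] Classical.propDecidable

/-! ### The statement -/

open Multigraph

namespace Matrix

/-- Multilinear expansion in the rows of the determinant of `diag(a) * A + B`. -/
theorem det_smul_add_eq_sum {ι τ : Type*} [Fintype ι] [DecidableEq ι]
    (a : ι → MvPolynomial τ ℤ) (A B : Matrix ι ι ℤ) :
    det (of fun i j => a i * MvPolynomial.C (A i j) + MvPolynomial.C (B i j)) =
      ∑ s : Finset ι, (∏ i ∈ s, a i) *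
        MvPolynomial.C (det (of fun i j => if i ∈ s then A i j else B i j)) := by
  let A' : ι → ι → MvPolynomial τ ℤ := fun i j => MvPolynomial.C (A i j)
  let B' : ι → ι → MvPolynomial τ ℤ := fun i j => MvPolynomial.C (B i j)
  have h := (detRowAlternating (R := MvPolynomial τ ℤ) (n := ι)).toMultilinearMap.map_add_univ
    (fun i => a i • A' i) B'
  refine h.trans (Finset.sum_congr rfl fun s _ => ?_)
  have hs : s.piecewise (fun i => a i • A' i) B' =
      s.piecewise (fun i => a i • s.piecewise A' B' i) (s.piecewise A' B') := by
    funext i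
    by_cases hi : i ∈ s <;> simp [hi]
  rw [hs, MultilinearMap.map_piecewise_smul, smul_eq_mul]
  congr 1
  rw [RingHom.map_det]
  change det (of (s.piecewise A' B')) = _
  congr 1
  ext i j
  by_cases hi : i ∈ s <;> simp [hi, A', B']

end Matrix

namespace MvPolynomial

/-- A sum of scalar multiples of distinct squarefree monomials vanishes only if all scalars do. -/
theorem sum_prod_mul_C_eq_zero_iff {α β τ : Type*} [Fintype α] [Fintype β]
    {f : α → τ} (hf : Function.Injective f) (c : Finset (α ⊕ β) → ℤ) :
    (∑ s : Finset (α ⊕ β), (∏ i ∈ s, Sum.elim (fun x => X (f x)) (fun _ => 0) i) * C (c s) :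
        MvPolynomial τ ℤ) = 0 ↔ ∀ s, (∀ b, Sum.inr b ∉ s) → c s = 0 := by
  constructor
  · intro h s
    induction s using Finset.strongInduction with
    | H s ih =>
      intro hs
      have h1 := congrArg (eval fun t => if ∃ x, f x = t ∧ Sum.inl x ∈ s then (1 : ℤ) else 0) h
      rw [map_sum, Finset.sum_eq_single s] at h1
      · rw [map_mul, map_prod, Finset.prod_eq_one, map_zero, one_mul, eval_C] at h1
        · exact h1
        · rintro (x | b) hx
          · have : ∃ y, f y = f x ∧ Sum.inl y ∈ s := ⟨x, rfl, hx⟩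
            simp [this]
          · exact absurd hx (hs b)
      · intro t _ hts
        rw [map_mul, map_prod, eval_C]
        by_cases hsub : t ⊆ s
        · rw [ih t (Finset.ssubset_iff_subset_ne.2 ⟨hsub, hts⟩) fun b hb => hs b (hsub hb),
            mul_zero]
        · obtain ⟨i, hit, his⟩ := Finset.not_subset.1 hsub
          rw [Finset.prod_eq_zero hit, zero_mul]
          rcases i with x | b
          · have : ¬ ∃ y, f y = f x ∧ Sum.inl y ∈ s := by
              rintro ⟨y, hy, hys⟩
              exact his (hf hy ▸ hys)
            simp [this]
          · simp
      · simp
  · intro h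
    refine Finset.sum_eq_zero fun s _ => ?_
    by_cases hs : ∀ b, Sum.inr b ∉ s
    · rw [h s hs, map_zero, mul_zero]
    · push Not at hs
      obtain ⟨b, hb⟩ := hs
      rw [Finset.prod_eq_zero hb (by simp), zero_mul]

end MvPolynomial

namespace Multigraph

/-- The incidence matrix with integer entries. -/
def incInt (G : Multigraph) (e : G.E) (v : G.V) : ℤ :=
  (if G.src e = v then 1 else 0) - (if G.tgt e = v then 1 else 0)

theorem incCol_eq_C (G : Multigraph) (e : G.E) (v : G.V) :
    G.incCol e v = MvPolynomial.C (G.incInt e v) := by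
  unfold incCol incInt
  split_ifs <;> simp

theorem sum_incInt_mul (G : Multigraph) (e : G.E) (w : G.V → ℤ) :
    ∑ v, G.incInt e v * w v = w (G.src e) - w (G.tgt e) := by
  simp [incInt, sub_mul, Finset.sum_sub_distrib]

theorem stepOn_symm (G : Multigraph) {T : Set G.E} {a b : G.V} (h : G.stepOn T a b) :
    G.stepOn T b a := by
  obtain ⟨e, he, h⟩ := h
  exact ⟨e, he, h.symm⟩

/-- Connectivity as injectivity of the coboundary map on potentials vanishing at `v0`. -/
theorem connectedOn_iff (G : Multigraph) (v0 : G.V) (T : Set G.E) :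
    G.ConnectedOn T ↔ ∀ w : G.V → ℤ, w v0 = 0 → (∀ e ∈ T, w (G.src e) = w (G.tgt e)) →
      w = 0 := by
  constructor
  · intro h w hw0 hw
    funext v
    have : ∀ b, G.reachOn T v0 b → w b = 0 := by
      intro b hb
      induction hb with
      | refl => exact hw0
      | tail _ hstep ih =>
        obtain ⟨e, he, ⟨rfl, rfl⟩ | ⟨rfl, rfl⟩⟩ := hstep
        · rw [← hw e he, ih]
        · rw [hw e he, ih]
    exact this v (h v0 v)
  · intro h
    have key := h (fun v => if G.reachOn T v0 v then 0 else 1)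
      (by simp [show G.reachOn T v0 v0 from Relation.ReflTransGen.refl])
      (by
        intro e he
        have : G.reachOn T v0 (G.src e) ↔ G.reachOn T v0 (G.tgt e) :=
          ⟨fun hr => hr.tail ⟨e, he, Or.inl ⟨rfl, rfl⟩⟩,
            fun hr => hr.tail ⟨e, he, Or.inr ⟨rfl, rfl⟩⟩⟩
        simp only [this])
    have hr : ∀ v, G.reachOn T v0 v := by
      intro v
      by_contra hv
      have := congrFun key v
      simp [hv] at this
    intro a b
    have : Std.Symm (G.stepOn T) := ⟨fun _ _ => G.stepOn_symm⟩
    have hsymm : G.reachOn T a v0 := Relation.ReflTransGen.stdSymm.symm _ _ (hr a)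
    exact hsymm.trans (hr b)

/-- The conservation law at `v0` follows from the ones at all other vertices. -/
theorem sum_mul_incInt_eq_zero (G : Multigraph) (v0 : G.V) (z : G.E → ℤ)
    (hz : ∀ v, v ≠ v0 → ∑ e, z e * G.incInt e v = 0) (v : G.V) :
    ∑ e, z e * G.incInt e v = 0 := by
  by_cases hv : v = v0
  · subst hv
    have htot : ∑ u, ∑ e, z e * G.incInt e u = 0 := by
      rw [Finset.sum_comm]
      refine Finset.sum_eq_zero fun e _ => ?_
      rw [← Finset.mul_sum]
      have := G.sum_incInt_mul e fun _ => 1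
      simp only [mul_one, sub_self] at this
      rw [this, mul_zero]
    rwa [Finset.sum_eq_single v (fun u _ hu => hz u hu) (by simp)] at htot
  · exact hz v hv

theorem sum_degOn (G : Multigraph) (T : Set G.E) : ∑ v, G.degOn T v = 2 * T.ncard := by
  have key : ∀ f : G.E → G.V, ∑ v, ({e ∈ T | f e = v}).ncard = T.ncard := by
    intro f
    rw [Set.ncard_eq_toFinset_card' T,
      Finset.card_eq_sum_card_fiberwise (f := f) (t := Finset.univ) (by simp)]
    refine Finset.sum_congr rfl fun v _ => ?_
    rw [Set.ncard_eq_toFinset_card']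
    congr 1
    ext e
    simp
  simp only [degOn, Finset.sum_add_distrib, key]
  ring

theorem degOn_ne_zero_of_mem (G : Multigraph) {T : Set G.E} {v : G.V}
    (hv : v ∈ G.edgeVerts T) : G.degOn T v ≠ 0 := by
  obtain ⟨e, he, h⟩ := hv
  intro h0
  rw [degOn, Nat.add_eq_zero_iff, Set.ncard_eq_zero, Set.ncard_eq_zero] at h0
  rcases h with h | h
  · exact (Set.eq_empty_iff_forall_notMem.1 h0.1 e) ⟨he, h.symm⟩
  · exact (Set.eq_empty_iff_forall_notMem.1 h0.2 e) ⟨he, h.symm⟩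

theorem incInt_eq_zero_of_notMem (G : Multigraph) {T : Set G.E} {e : G.E} {v : G.V}
    (he : e ∈ T) (hv : v ∉ G.edgeVerts T) : G.incInt e v = 0 := by
  have h1 : G.src e ≠ v := fun h => hv ⟨e, he, Or.inl h.symm⟩
  have h2 : G.tgt e ≠ v := fun h => hv ⟨e, he, Or.inr h.symm⟩
  simp [incInt, h1, h2]

/-- The boundary of `z` at a vertex of degree one in the support of `z` is nonzero. -/
theorem sum_mul_incInt_ne_zero (G : Multigraph) {z : G.E → ℤ} {v : G.V}
    (hv : G.degOn {e | z e ≠ 0} v = 1) : ∑ e, z e * G.incInt e v ≠ 0 := by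
  have hsplit : ∑ e, z e * G.incInt e v =
      (∑ e, if G.src e = v then z e else 0) - ∑ e, if G.tgt e = v then z e else 0 := by
    simp [incInt, mul_sub, Finset.sum_sub_distrib]
  have hone : ∀ f : G.E → G.V, ({e ∈ {e | z e ≠ 0} | f e = v}).ncard = 1 →
      (∑ e, if f e = v then z e else 0) ≠ 0 := by
    intro f hf
    obtain ⟨a, ha⟩ := Set.ncard_eq_one.1 hf
    have hmem : a ∈ {e ∈ {e | z e ≠ 0} | f e = v} := by rw [ha]; rfl
    rw [Finset.sum_eq_single a]
    · rw [if_pos hmem.2]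
      exact hmem.1
    · intro b _ hb
      by_contra hne
      have hfb : f b = v := by
        by_contra h
        simp [h] at hne
      rw [if_pos hfb] at hne
      have : b ∈ {e ∈ {e | z e ≠ 0} | f e = v} := ⟨hne, hfb⟩
      rw [ha] at this
      exact hb this
    · simp
  have hzero : ∀ f : G.E → G.V, ({e ∈ {e | z e ≠ 0} | f e = v}).ncard = 0 →
      (∑ e, if f e = v then z e else 0) = 0 := by
    intro f hf
    rw [Set.ncard_eq_zero] at hf
    refine Finset.sum_eq_zero fun e _ => ?_
    by_contra hne
    have hfe : f e = v := by
      by_contra h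
      simp [h] at hne
    rw [if_pos hfe] at hne
    exact Set.eq_empty_iff_forall_notMem.1 hf e ⟨hne, hfe⟩
  rw [hsplit]
  rcases Nat.add_eq_one_iff.1 hv with ⟨h0, h1⟩ | ⟨h1, h0⟩
  · rw [hzero _ h0, zero_sub]
    exact neg_ne_zero.2 (hone _ h1)
  · rw [hzero _ h0, sub_zero]
    exact hone _ h1

/-- A nonempty edge set without vertices of degree one supports a nonzero circulation. -/
theorem exists_circulation (G : Multigraph) {T : Set G.E} (hne : T.Nonempty)
    (hdeg : ∀ v, G.degOn T v ≠ 1) :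
    ∃ z : G.E → ℤ, z ≠ 0 ∧ (∀ e ∉ T, z e = 0) ∧ ∀ v, ∑ e, z e * G.incInt e v = 0 := by
  obtain ⟨e0, he0⟩ := hne
  set u := G.src e0
  have hu : u ∈ G.edgeVerts T := ⟨e0, he0, Or.inl rfl⟩
  have hcard : (G.edgeVerts T).ncard ≤ T.ncard := by
    have h1 : ∑ v ∈ (G.edgeVerts T).toFinset, 2 ≤ ∑ v, G.degOn T v := by
      refine (Finset.sum_le_sum fun v hv => ?_).trans
        (Finset.sum_le_sum_of_subset (Finset.subset_univ _))
      have h0 := G.degOn_ne_zero_of_mem (Set.mem_toFinset.1 hv)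
      have := hdeg v
      omega
    rw [sum_degOn, Finset.sum_const, smul_eq_mul, ← Set.ncard_eq_toFinset_card'] at h1
    omega
  let W := {v : G.V // v ∈ G.edgeVerts T \ {u}}
  have hlt : Fintype.card W < Fintype.card T := by
    have h1 : Fintype.card W = (G.edgeVerts T \ {u}).ncard := by
      rw [← Nat.card_eq_fintype_card, ← Nat.card_coe_set_eq]
    have h2 : Fintype.card T = T.ncard := by
      rw [← Nat.card_eq_fintype_card, ← Nat.card_coe_set_eq]
    have h3 := Set.ncard_sdiff_singleton_lt_of_mem hu
    omega
  let L : (T → ℤ) →ₗ[ℤ] (W → ℤ) := Matrix.mulVecLin (Matrix.of fun w e => G.incInt e.1 w.1)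
  have hker : LinearMap.ker L ≠ ⊥ := by
    intro h
    have := LinearMap.finrank_le_finrank_of_injective (LinearMap.ker_eq_bot.1 h)
    simp only [Module.finrank_fintype_fun_eq_card] at this
    omega
  obtain ⟨y, hy, hy0⟩ := (Submodule.ne_bot_iff _).1 hker
  have hsum : ∀ v, ∑ e, (if h : e ∈ T then y ⟨e, h⟩ else 0) * G.incInt e v =
      ∑ e : T, G.incInt e.1 v * y e := by
    intro v
    rw [← Finset.sum_subset (Finset.subset_univ T.toFinset)]
    · rw [← Finset.sum_coe_sort]
      refine Fintype.sum_equiv (Equiv.subtypeEquivRight (by simp)) _ _ ?_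
      rintro ⟨e, he⟩
      have he' : e ∈ T := by simpa using he
      rw [dif_pos he', mul_comm]
      rfl
    · intro e _ he
      have he' : e ∉ T := by simpa using he
      simp [he']
  refine ⟨fun e => if h : e ∈ T then y ⟨e, h⟩ else 0, ?_, fun e he => dif_neg he, ?_⟩
  · intro h
    apply hy0
    funext e
    simpa [e.2] using congrFun h e.1
  · refine G.sum_mul_incInt_eq_zero u _ fun v hv => ?_
    rw [hsum v]
    by_cases hvT : v ∈ G.edgeVerts T
    · exact congrFun (LinearMap.mem_ker.1 hy) ⟨v, hvT, hv⟩
    · exact Finset.sum_eq_zero fun e _ => by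
        rw [G.incInt_eq_zero_of_notMem e.2 hvT, zero_mul]

/-- Acyclicity as linear independence of the rows of the reduced incidence matrix. -/
theorem isForest_iff (G : Multigraph) (v0 : G.V) (T : Set G.E) :
    G.IsForest T ↔ ∀ z : G.E → ℤ, (∀ e ∉ T, z e = 0) →
      (∀ v, v ≠ v0 → ∑ e, z e * G.incInt e v = 0) → z = 0 := by
  constructor
  · intro h z hzT hz
    by_contra hne
    obtain ⟨e, he⟩ := Function.ne_iff.1 hne
    obtain ⟨v, hv⟩ := h {e | z e ≠ 0} (fun e he => by_contra fun h => he (hzT e h)) ⟨e, he⟩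
    exact G.sum_mul_incInt_ne_zero hv (G.sum_mul_incInt_eq_zero v0 z hz v)
  · intro h T' hT' hne
    by_contra hdeg
    push Not at hdeg
    obtain ⟨z, hz0, hzT, hz⟩ := G.exists_circulation hne hdeg
    exact hz0 (h z (fun e he => hzT e fun he' => he (hT' he')) fun v _ => hz v)

end Multigraph

theorem Fintype.sum_subtype_eq_sum {α : Type*} [Fintype α] (p : α → Prop)
    [Fintype {a // p a}] (f : α → ℤ) (hf : ∀ a, ¬ p a → f a = 0) :
    ∑ x : {a // p a}, f x.1 = ∑ a, f a := by
  rw [← Finset.sum_subtype (Finset.univ.filter p) (by simp) f]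
  refine Finset.sum_subset (Finset.subset_univ _) fun a _ ha => hf a ?_
  simpa using ha

namespace Multigraph

variable (G : Multigraph) (v0 : G.V) {I J : Set G.E}
  (σ : {e : G.E // e ∉ I} ≃ {e : G.E // e ∉ J}) (D : Set G.E)

/-- The integer matrix whose determinant is the coefficient of `∏ e ∈ D, x_e` in the Dodgson
polynomial with deleted rows `I` and deleted columns `J`. -/
def coeffMatrix :
    Matrix ({e : G.E // e ∉ I} ⊕ {v : G.V // v ≠ v0})
      ({e : G.E // e ∉ I} ⊕ {v : G.V // v ≠ v0}) ℤ :=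
  Matrix.of fun r c =>
    match r, c with
    | Sum.inl e, Sum.inl x => if e.1 ∈ D ∧ e.1 = (σ x).1 then 1 else 0
    | Sum.inl e, Sum.inr v => if e.1 ∈ D then 0 else G.incInt e.1 v.1
    | Sum.inr v, Sum.inl x => - G.incInt (σ x).1 v.1
    | Sum.inr _, Sum.inr _ => 0

variable {v0 D}

theorem sum_incInt_mul_ne {w : G.V → ℤ} (hw : w v0 = 0) (e : G.E) :
    ∑ v : {v : G.V // v ≠ v0}, G.incInt e v.1 * w v.1 = w (G.src e) - w (G.tgt e) := by
  rw [Fintype.sum_subtype_eq_sum (fun v => v ≠ v0) fun v => G.incInt e v * w v, sum_incInt_mul]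
  intro v hv
  rw [not_not.1 hv, hw, mul_zero]

theorem coeffMatrix_mulVec_inl (hDJ : Disjoint D J) {z : G.E → ℤ} {w : G.V → ℤ} (hw : w v0 = 0)
    (e : {e : G.E // e ∉ I}) :
    (G.coeffMatrix v0 σ D).mulVec (Sum.elim (fun x => z (σ x).1) fun v => w v.1) (Sum.inl e) =
      if e.1 ∈ D then z e.1 else w (G.src e.1) - w (G.tgt e.1) := by
  simp only [Matrix.mulVec, dotProduct, Fintype.sum_sum_type, coeffMatrix, Matrix.of_apply,
    Sum.elim_inl, Sum.elim_inr]
  by_cases he : e.1 ∈ D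
  · have heJ : e.1 ∉ J := fun h => Set.disjoint_left.1 hDJ he h
    rw [Finset.sum_eq_single (σ.symm ⟨e.1, heJ⟩)]
    · simp [he]
    · intro x _ hx
      have : e.1 ≠ (σ x).1 := by
        intro h
        apply hx
        rw [Equiv.eq_symm_apply]
        exact Subtype.ext h.symm
      simp [this]
    · simp
  · simp [he, G.sum_incInt_mul_ne hw]

theorem coeffMatrix_mulVec_inr {z : G.E → ℤ} {w : G.V → ℤ} (hz : ∀ e ∈ J, z e = 0)
    (v : {v : G.V // v ≠ v0}) :
    (G.coeffMatrix v0 σ D).mulVec (Sum.elim (fun x => z (σ x).1) fun v => w v.1) (Sum.inr v) =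
      - ∑ e, z e * G.incInt e v.1 := by
  simp only [Matrix.mulVec, dotProduct, Fintype.sum_sum_type, coeffMatrix, Matrix.of_apply,
    Sum.elim_inl, Sum.elim_inr, zero_mul, Finset.sum_const_zero, add_zero, neg_mul,
    Finset.sum_neg_distrib]
  rw [σ.sum_comp fun y => G.incInt y.1 v.1 * z y.1,
    Fintype.sum_subtype_eq_sum (fun e => e ∉ J) fun e => G.incInt e v.1 * z e]
  · simp only [mul_comm]
  · intro e he
    rw [hz e (not_not.1 he), mul_zero]

theorem coeffMatrix_vecMul_inl (hDI : Disjoint D I) {y : G.E → ℤ} {w : G.V → ℤ} (hw : w v0 = 0)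
    (x : {e : G.E // e ∉ I}) :
    Matrix.vecMul (Sum.elim (fun e => y e.1) fun v => w v.1) (G.coeffMatrix v0 σ D) (Sum.inl x) =
      (if (σ x).1 ∈ D then y (σ x).1 else 0) - (w (G.src (σ x).1) - w (G.tgt (σ x).1)) := by
  simp only [Matrix.vecMul, dotProduct, Fintype.sum_sum_type, coeffMatrix, Matrix.of_apply,
    Sum.elim_inl, Sum.elim_inr, mul_neg, Finset.sum_neg_distrib]
  rw [← G.sum_incInt_mul_ne hw, sub_eq_add_neg]
  congr 1
  · by_cases he : (σ x).1 ∈ D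
    · have heI : (σ x).1 ∉ I := fun h => Set.disjoint_left.1 hDI he h
      rw [Finset.sum_eq_single ⟨(σ x).1, heI⟩]
      · simp [he]
      · intro b _ hb
        have : b.1 ≠ (σ x).1 := fun h => hb (Subtype.ext h)
        simp [this]
      · simp
    · rw [if_neg he]
      refine Finset.sum_eq_zero fun b _ => ?_
      rw [if_neg, mul_zero]
      rintro ⟨hb, h⟩
      exact he (h ▸ hb)
  · simp only [mul_comm]

theorem coeffMatrix_vecMul_inr {y : G.E → ℤ} {w : G.V → ℤ} (hy : ∀ e ∈ I, y e = 0)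
    (v : {v : G.V // v ≠ v0}) :
    Matrix.vecMul (Sum.elim (fun e => y e.1) fun v => w v.1) (G.coeffMatrix v0 σ D) (Sum.inr v) =
      ∑ e, if e ∈ D then 0 else y e * G.incInt e v.1 := by
  simp only [Matrix.vecMul, dotProduct, Fintype.sum_sum_type, coeffMatrix, Matrix.of_apply,
    Sum.elim_inl, Sum.elim_inr, mul_zero, Finset.sum_const_zero, add_zero, mul_ite]
  refine Fintype.sum_subtype_eq_sum (fun e => e ∉ I)
    (fun e => if e ∈ D then 0 else y e * G.incInt e v.1) fun e he => ?_
  rw [hy e (not_not.1 he), zero_mul, ite_self]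

theorem connectedOn_row_of_det_ne_zero (hDJ : Disjoint D J)
    (hdet : (G.coeffMatrix v0 σ D).det ≠ 0) : G.ConnectedOn (I ∪ D)ᶜ := by
  rw [G.connectedOn_iff v0]
  intro w hw0 hw
  have h := Matrix.eq_zero_of_mulVec_eq_zero hdet
    (v := Sum.elim (fun _ => 0) fun v => w v.1) (by
      funext r
      rcases r with e | v
      · refine (G.coeffMatrix_mulVec_inl σ hDJ (z := 0) hw0 e).trans ?_
        split_ifs with he
        · rfl
        · rw [hw e.1 (fun h => h.elim e.2 he), sub_self]
          rfl
      · refine (G.coeffMatrix_mulVec_inr σ (z := 0) (by simp) v).trans ?_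
        simp)
  funext v
  by_cases hv : v = v0
  · rw [hv, hw0]
    rfl
  · exact congrFun h (Sum.inr ⟨v, hv⟩)

theorem isForest_column_of_det_ne_zero (hDJ : Disjoint D J)
    (hdet : (G.coeffMatrix v0 σ D).det ≠ 0) : G.IsForest (J ∪ D)ᶜ := by
  rw [G.isForest_iff v0]
  intro z hz hzv
  have hzJ : ∀ e ∈ J, z e = 0 := fun e he => hz e fun h => h (Or.inl he)
  have hzD : ∀ e ∈ D, z e = 0 := fun e he => hz e fun h => h (Or.inr he)
  have h := Matrix.eq_zero_of_mulVec_eq_zero hdet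
    (v := Sum.elim (fun x => z (σ x).1) fun _ => 0) (by
      funext r
      rcases r with e | v
      · refine (G.coeffMatrix_mulVec_inl σ hDJ (z := z) (w := 0) rfl e).trans ?_
        split_ifs with he
        · exact hzD _ he
        · rfl
      · refine (G.coeffMatrix_mulVec_inr σ (w := 0) hzJ v).trans ?_
        rw [hzv v.1 v.2]
        rfl)
  funext e
  by_cases he : e ∈ J
  · exact hzJ e he
  · simpa using congrFun h (Sum.inl (σ.symm ⟨e, he⟩))

theorem connectedOn_column_of_det_ne_zero (hDI : Disjoint D I)
    (hdet : (G.coeffMatrix v0 σ D).det ≠ 0) : G.ConnectedOn (J ∪ D)ᶜ := by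
  rw [G.connectedOn_iff v0]
  intro w hw0 hw
  let y : G.E → ℤ := fun e => if e ∈ D then w (G.src e) - w (G.tgt e) else 0
  have h := Matrix.eq_zero_of_vecMul_eq_zero hdet
    (v := Sum.elim (fun e => y e.1) fun v => w v.1) (by
      funext r
      rcases r with x | v
      · refine (G.coeffMatrix_vecMul_inl σ hDI hw0 x).trans ?_
        split_ifs with hx
        · simp [y, hx]
        · rw [hw (σ x).1 (fun h => h.elim (σ x).2 hx)]
          simp
      · refine (G.coeffMatrix_vecMul_inr σ (fun e he => ?_) v).trans ?_
        · exact if_neg fun h => Set.disjoint_left.1 hDI h he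
        · refine Finset.sum_eq_zero fun e _ => ?_
          split_ifs with he
          · rfl
          · simp [y, he])
  funext v
  by_cases hv : v = v0
  · rw [hv, hw0]
    rfl
  · exact congrFun h (Sum.inr ⟨v, hv⟩)

theorem isForest_row_of_det_ne_zero (hDI : Disjoint D I)
    (hdet : (G.coeffMatrix v0 σ D).det ≠ 0) : G.IsForest (I ∪ D)ᶜ := by
  rw [G.isForest_iff v0]
  intro z hz hzv
  have hzI : ∀ e ∈ I, z e = 0 := fun e he => hz e fun h => h (Or.inl he)
  have hzD : ∀ e ∈ D, z e = 0 := fun e he => hz e fun h => h (Or.inr he)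
  have h := Matrix.eq_zero_of_vecMul_eq_zero hdet
    (v := Sum.elim (fun e => z e.1) fun _ => 0) (by
      funext r
      rcases r with x | v
      · refine (G.coeffMatrix_vecMul_inl σ hDI (y := z) (w := 0) rfl x).trans ?_
        split_ifs with hx
        · simp [hzD _ hx]
        · simp
      · refine (G.coeffMatrix_vecMul_inr σ (w := 0) hzI v).trans ?_
        refine (Finset.sum_congr rfl fun e _ => ?_).trans (hzv v.1 v.2)
        split_ifs with he
        · rw [hzD e he, zero_mul]
        · rfl)
  funext e
  by_cases he : e ∈ I
  · exact hzI e he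
  · exact congrFun h (Sum.inl ⟨e, he⟩)

theorem det_coeffMatrix_ne_zero (hDI : Disjoint D I) (hDJ : Disjoint D J)
    (hconn : G.ConnectedOn (I ∪ D)ᶜ) (hforest : G.IsForest (J ∪ D)ᶜ) :
    (G.coeffMatrix v0 σ D).det ≠ 0 := by
  rw [G.connectedOn_iff v0] at hconn
  rw [G.isForest_iff v0] at hforest
  intro hdet
  obtain ⟨u, hu0, hu⟩ := Matrix.exists_mulVec_eq_zero_iff.2 hdet
  apply hu0
  let z : G.E → ℤ := fun e => if h : e ∉ J then u (Sum.inl (σ.symm ⟨e, h⟩)) else 0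
  let w : G.V → ℤ := fun v => if h : v ≠ v0 then u (Sum.inr ⟨v, h⟩) else 0
  have hw0 : w v0 = 0 := by simp [w]
  have hzJ : ∀ e ∈ J, z e = 0 := fun e he => dif_neg (not_not.2 he)
  have huzw : u = Sum.elim (fun x => z (σ x).1) fun v => w v.1 := by
    funext r
    rcases r with x | v
    · simp [z, (σ x).2]
    · simp [w, v.2]
  rw [huzw] at hu
  have hrow : ∀ e : {e : G.E // e ∉ I},
      (if e.1 ∈ D then z e.1 else w (G.src e.1) - w (G.tgt e.1)) = 0 := fun e =>
    (G.coeffMatrix_mulVec_inl σ hDJ hw0 e).symm.trans (congrFun hu (Sum.inl e))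
  have hw : w = 0 := by
    refine hconn w hw0 fun e he => ?_
    have := hrow ⟨e, fun h => he (Or.inl h)⟩
    rw [if_neg fun h => he (Or.inr h)] at this
    exact sub_eq_zero.1 this
  have hz : z = 0 := by
    refine hforest z (fun e he => ?_) fun v hv => ?_
    · by_cases heJ : e ∈ J
      · exact hzJ e heJ
      · have heD : e ∈ D := (not_not.1 he).resolve_left heJ
        by_cases heI : e ∈ I
        · exact absurd heI (Set.disjoint_left.1 hDI heD)
        · have := hrow ⟨e, heI⟩
          rwa [if_pos heD] at this
    · have := (G.coeffMatrix_mulVec_inr σ (D := D) (w := w) hzJ ⟨v, hv⟩).symm.trans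
        (congrFun hu (Sum.inr ⟨v, hv⟩))
      exact neg_eq_zero.1 this
  rw [huzw, hz, hw]
  funext r
  rcases r with x | v <;> rfl

/-- The coefficients of the Dodgson polynomial detect pairs of spanning trees. -/
theorem det_coeffMatrix_ne_zero_iff (hDI : Disjoint D I) (hDJ : Disjoint D J) :
    (G.coeffMatrix v0 σ D).det ≠ 0 ↔
      G.IsSpanningTree (I ∪ D)ᶜ ∧ G.IsSpanningTree (J ∪ D)ᶜ :=
  ⟨fun h => ⟨⟨G.isForest_row_of_det_ne_zero σ hDI h, G.connectedOn_row_of_det_ne_zero σ hDJ h⟩,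
      G.isForest_column_of_det_ne_zero σ hDJ h, G.connectedOn_column_of_det_ne_zero σ hDI h⟩,
    fun h => G.det_coeffMatrix_ne_zero σ hDI hDJ h.1.2 h.2.1⟩

variable (v0)

/-- The part of the (row- and column-deleted) expanded Kirchhoff matrix multiplying the edge
variables outside `K`. -/
def diagMatrix (K : Set G.E) :
    Matrix ({e : G.E // e ∉ I} ⊕ {v : G.V // v ≠ v0})
      ({e : G.E // e ∉ I} ⊕ {v : G.V // v ≠ v0}) ℤ :=
  Matrix.of fun r c =>
    match r, c with
    | Sum.inl e, Sum.inl x => if e.1 ∉ K ∧ e.1 = (σ x).1 then 1 else 0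
    | _, _ => 0

theorem coeffMatrix_image_inl (K : Set G.E)
    (s : Finset ({e : G.E // e ∉ I} ⊕ {v : G.V // v ≠ v0})) (hs : ∀ v, Sum.inr v ∉ s)
    (hK : ∀ e, Sum.inl e ∈ s → e.1 ∉ K) :
    (Matrix.of fun r c => if r ∈ s then G.diagMatrix v0 σ K r c else G.coeffMatrix v0 σ ∅ r c) =
      G.coeffMatrix v0 σ {e | ∃ h : e ∉ I, Sum.inl ⟨e, h⟩ ∈ s} := by
  ext r c
  rcases r with e | v
  · by_cases he : Sum.inl e ∈ s
    · have := hK e he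
      rcases c with x | v <;> simp [coeffMatrix, diagMatrix, he, e.2, this]
    · rcases c with x | v <;> simp [coeffMatrix, he]
  · rcases c with x | v' <;> simp [coeffMatrix, hs v]

theorem dodgson_eq_sum (K : Set G.E) (h : Nonempty ({e : G.E // e ∉ I} ≃ {e : G.E // e ∉ J})) :
    G.dodgson v0 I J K = ∑ s : Finset ({e : G.E // e ∉ I} ⊕ {v : G.V // v ≠ v0}),
      (∏ i ∈ s, Sum.elim (fun x => MvPolynomial.X x.1) (fun _ => 0) i) *
        MvPolynomial.C (Matrix.det (Matrix.of fun r c =>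
          if r ∈ s then G.diagMatrix v0 h.some K r c else G.coeffMatrix v0 h.some ∅ r c)) := by
  rw [← Matrix.det_smul_add_eq_sum, dodgson, dif_pos h, AlgHom.map_det]
  congr 1
  ext1 r c
  rcases r with e | v <;> rcases c with x | v' <;>
    simp only [AlgHom.mapMatrix_apply, Matrix.map_apply, Matrix.of_apply, bigMatrix, coeffMatrix,
      diagMatrix, Sum.map_inl, Sum.map_inr, Sum.elim_inl, Sum.elim_inr, incCol_eq_C, id]
  · by_cases hex : e.1 = (h.some x).1
    · by_cases heK : e.1 ∈ K
      · simp [← hex, heK]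
      · simp [← hex, heK]
    · simp [hex]
  · simp
  · simp
  · simp

/-- A Dodgson polynomial vanishes iff no edge set `D` disjoint from `I ∪ J ∪ K` makes the
complements of `I ∪ D` and `J ∪ D` spanning trees. -/
theorem dodgson_eq_zero_iff (K : Set G.E) (hIJ : I.ncard = J.ncard) :
    G.dodgson v0 I J K = 0 ↔ ∀ D : Set G.E, Disjoint D (I ∪ J ∪ K) →
      ¬ (G.IsSpanningTree (I ∪ D)ᶜ ∧ G.IsSpanningTree (J ∪ D)ᶜ) := by
  have h : Nonempty ({e : G.E // e ∉ I} ≃ {e : G.E // e ∉ J}) := by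
    have h1 : Iᶜ.ncard = Jᶜ.ncard := by
      rw [Set.ncard_compl, Set.ncard_compl, hIJ]
    exact Finite.card_eq.1 h1
  rw [G.dodgson_eq_sum v0 K h, MvPolynomial.sum_prod_mul_C_eq_zero_iff Subtype.val_injective]
  constructor
  · intro hs D hD
    rw [Set.disjoint_union_right, Set.disjoint_union_right] at hD
    obtain ⟨⟨hDI, hDJ⟩, hDK⟩ := hD
    rw [← G.det_coeffMatrix_ne_zero_iff (v0 := v0) h.some hDI hDJ, not_not]
    let s : Finset ({e : G.E // e ∉ I} ⊕ {v : G.V // v ≠ v0}) :=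
      Finset.univ.filter fun r => ∃ e, r = Sum.inl e ∧ e.1 ∈ D
    have hsv : ∀ v, Sum.inr v ∉ s := by simp [s]
    have hmem : ∀ e, Sum.inl e ∈ s ↔ e.1 ∈ D := fun e => by
      simp only [s, Finset.mem_filter_univ, Sum.inl.injEq, exists_eq_left']
    have hDs : {e | ∃ h : e ∉ I, Sum.inl ⟨e, h⟩ ∈ s} = D := by
      ext e
      simp only [Set.mem_ofPred_eq, hmem, exists_prop, and_iff_right_iff_imp]
      exact fun he => Set.disjoint_left.1 hDI he
    have := hs s hsv
    rwa [G.coeffMatrix_image_inl v0 h.some K s hsv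
      fun e he => Set.disjoint_left.1 hDK ((hmem e).1 he), hDs] at this
  · intro hD s hsv
    by_cases hbad : ∃ e, Sum.inl e ∈ s ∧ (e.1 ∈ J ∨ e.1 ∈ K)
    · obtain ⟨e, hes, he⟩ := hbad
      refine Matrix.det_eq_zero_of_row_eq_zero (Sum.inl e) fun c => ?_
      rw [Matrix.of_apply, if_pos hes]
      rcases c with x | v
      · refine if_neg ?_
        rintro ⟨heK, hex⟩
        exact he.elim (fun heJ => (h.some x).2 (hex ▸ heJ)) heK
      · rfl
    · push Not at hbad
      rw [G.coeffMatrix_image_inl v0 h.some K s hsv fun e he => (hbad e he).2]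
      have hDI : Disjoint {e | ∃ h : e ∉ I, Sum.inl ⟨e, h⟩ ∈ s} I :=
        Set.disjoint_left.2 fun e he => he.1
      have hDJ : Disjoint {e | ∃ h : e ∉ I, Sum.inl ⟨e, h⟩ ∈ s} J :=
        Set.disjoint_left.2 fun e he => (hbad _ he.2).1
      have hDK : Disjoint {e | ∃ h : e ∉ I, Sum.inl ⟨e, h⟩ ∈ s} K :=
        Set.disjoint_left.2 fun e he => (hbad _ he.2).2
      have := hD _ (Set.disjoint_union_right.2 ⟨Set.disjoint_union_right.2 ⟨hDI, hDJ⟩, hDK⟩)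
      rwa [← G.det_coeffMatrix_ne_zero_iff (v0 := v0) h.some hDI hDJ, not_not] at this

end Multigraph

namespace Multigraph

/-- Passing to the dual graph turns `(I, J, K)` into `(S \ I, S \ J, I ∩ J)`. -/
theorem DodgsonConfig.dual {G G' : Multigraph} (φ : G.E ≃ G'.E) {S I J K : Set G.E}
    (hS : S.ncard = 5) (h : G.DodgsonConfig S I J K) :
    G'.DodgsonConfig (φ '' S) (φ '' (S \ I)) (φ '' (S \ J)) (φ '' (I ∩ J)) := by
  obtain ⟨hU, hcase⟩ := h
  have hI : I ⊆ S := by rw [← hU]; intro e he; exact Or.inl (Or.inl he)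
  have hJ : J ⊆ S := by rw [← hU]; intro e he; exact Or.inl (Or.inr he)
  have hcI := Set.ncard_sdiff hI
  have hcJ := Set.ncard_sdiff hJ
  refine ⟨?_, ?_⟩
  · rw [← Set.image_union, ← Set.image_union]
    congr 1
    ext e
    have := @hI e
    have := @hJ e
    simp only [Set.mem_union, Set.mem_sdiff, Set.mem_inter_iff]
    tauto
  simp only [← Set.image_inter φ.injective, Set.ncard_image_of_injective _ φ.injective,
    Set.image_eq_empty]
  rcases hcase with ⟨h1, h2, h3, h4, h5, h6⟩ | ⟨h1, h2, h3, h4⟩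
  · refine Or.inr ⟨by omega, by omega, h4, ?_⟩
    rw [← h3]
    congr 1
    ext e
    have h5 := Set.eq_empty_iff_forall_notMem.1 h5 e
    have h6 := Set.eq_empty_iff_forall_notMem.1 h6 e
    rw [← hU]
    simp only [Set.mem_union, Set.mem_sdiff, Set.mem_inter_iff] at *
    tauto
  · refine Or.inl ⟨by omega, by omega, h4, ?_, ?_, ?_⟩
    · ext e
      rw [← hU, h3]
      simp only [Set.mem_union, Set.mem_sdiff, Set.mem_inter_iff, Set.mem_empty_iff_false]
      tauto
    · ext e
      simp only [Set.mem_sdiff, Set.mem_inter_iff, Set.mem_empty_iff_false]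
      tauto
    · ext e
      simp only [Set.mem_sdiff, Set.mem_inter_iff, Set.mem_empty_iff_false]
      tauto

theorem DodgsonConfig.ncard_eq {G : Multigraph} {S I J K : Set G.E}
    (h : G.DodgsonConfig S I J K) : I.ncard = J.ncard := by
  rcases h.2 with h | h <;> rw [h.1, h.2.1]

theorem FeynmanSplit.dual {G G' : Multigraph} (hG : G.Connected) (φ : G.E ≃ G'.E)
    (hdual : ∀ T : Set G.E, G.IsSpanningTree T ↔ G'.IsSpanningTree (φ '' Tᶜ))
    (h : G.FeynmanSplit) : G'.FeynmanSplit := by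
  intro S' hS'
  obtain ⟨v, -⟩ := hG.1
  obtain ⟨S, rfl⟩ : ∃ S : Set G.E, φ '' S = S' := ⟨φ ⁻¹' S', φ.image_preimage S'⟩
  rw [Set.ncard_image_of_injective _ φ.injective] at hS'
  obtain ⟨I, J, K, hcfg, h0⟩ := h S hS'
  have hcfg' := hcfg.dual φ hS'
  refine ⟨_, _, _, hcfg', fun v' => ?_⟩
  rw [G'.dodgson_eq_zero_iff v' _ hcfg'.ncard_eq, hcfg'.1]
  intro D' hD' htrees
  obtain ⟨D, rfl⟩ : ∃ D : Set G.E, φ '' D = D' := ⟨φ ⁻¹' D', φ.image_preimage D'⟩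
  rw [Set.disjoint_image_iff φ.injective] at hD'
  have hzero := (G.dodgson_eq_zero_iff v K hcfg.ncard_eq).1 (h0 v)
  rw [hcfg.1] at hzero
  have key : ∀ A ⊆ S, G'.IsSpanningTree (φ '' (S \ A) ∪ φ '' D)ᶜ →
      G.IsSpanningTree (A ∪ (S ∪ D)ᶜ)ᶜ := by
    intro A hA hT
    rw [hdual]
    convert! hT using 1
    rw [← Set.image_union, ← Set.image_compl_eq φ.bijective]
    congr 1
    ext e
    have := @hA e
    have := fun he : e ∈ D => Set.disjoint_left.1 hD' he
    simp only [Set.mem_union, Set.mem_sdiff, Set.mem_compl_iff]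
    tauto
  have hI : I ⊆ S := by rw [← hcfg.1]; intro e he; exact Or.inl (Or.inl he)
  have hJ : J ⊆ S := by rw [← hcfg.1]; intro e he; exact Or.inl (Or.inr he)
  refine hzero (S ∪ D)ᶜ ?_ ⟨key I hI htrees.1, key J hJ htrees.2⟩
  exact Set.disjoint_left.2 fun e he heS => he (Or.inl heS)

end Multigraph

theorem stmt6 (G G' : Multigraph) (hG : G.Connected) (hG' : G'.Connected)
    (φ : G.E ≃ G'.E)
    (hdual : ∀ T : Set G.E, G.IsSpanningTree T ↔ G'.IsSpanningTree (φ '' Tᶜ)) :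
    G.FeynmanSplit ↔ G'.FeynmanSplit := by
  refine ⟨FeynmanSplit.dual hG φ hdual, FeynmanSplit.dual hG' φ.symm fun T => ?_⟩
  rw [hdual, ← Set.image_compl_eq φ.symm.bijective, compl_compl, Equiv.image_symm_image]
end
end

section
/- None of the graphs K_{3,3}, K_5, the cube C, the octahedron O, and H is Feynman 5-split; each of these five graphs contains a 5-configuration that does not split. -/
/-!  Common definitions: multigraphs, separations, width, minors,
Kirchhoff/Dodgson polynomials, Feynman 5-splitting, enhanced graphs. -/

noncomputable section

attribute [local instance] Classical.propDecidable

/-! ### The statement -/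

open Multigraph

namespace Multigraph

/-- A function that is constant along the edges of `T` is constant on everything reachable
along `T`. -/
theorem eq_of_reachOn {G : Multigraph} {R : Type*} {T : Set G.E} {w : G.V → R}
    (hw : ∀ e ∈ T, w (G.src e) = w (G.tgt e)) {a b : G.V} (h : G.reachOn T a b) :
    w a = w b := by
  induction h with
  | refl => rfl
  | tail _ hstep ih =>
    obtain ⟨e, he, ⟨rfl, rfl⟩ | ⟨rfl, rfl⟩⟩ := hstep
    · exact ih.trans (hw e he)
    · exact ih.trans (hw e he).symm

/-- If `T` spans `G` and has `|V| - 1` edges, then every function on `T` is the coboundary of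
a function on the vertices. -/
theorem exists_sub_eq_of_spanning {G : Multigraph} {T : Set G.E} {v₀ : G.V}
    (hT : ∀ v, G.reachOn T v₀ v) (hcard : T.ncard + 1 = Fintype.card G.V) (z : T → ℚ) :
    ∃ w : G.V → ℚ, w v₀ = 0 ∧ ∀ e : T, w (G.src e) - w (G.tgt e) = z e := by
  let ext (u : {v : G.V // v ≠ v₀} → ℚ) (v : G.V) : ℚ := if h : v = v₀ then 0 else u ⟨v, h⟩
  let δ : ({v : G.V // v ≠ v₀} → ℚ) →ₗ[ℚ] (T → ℚ) :=
    { toFun := fun u e => ext u (G.src e) - ext u (G.tgt e)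
      map_add' := by
        intro u u'
        funext e
        simp only [ext, Pi.add_apply]
        split_ifs <;> ring
      map_smul' := by
        intro a u
        funext e
        simp only [ext, Pi.smul_apply, smul_eq_mul, RingHom.id_apply]
        split_ifs <;> ring }
  have hinj : Function.Injective δ := by
    rw [injective_iff_map_eq_zero]
    intro u hu
    funext v
    have hconst : ext u v₀ = ext u v :=
      eq_of_reachOn (fun e he => sub_eq_zero.mp (congrFun hu ⟨e, he⟩)) (hT v)
    simpa [ext, v.2] using hconst.symm
  have hdim : Module.finrank ℚ ({v : G.V // v ≠ v₀} → ℚ) = Module.finrank ℚ (T → ℚ) := by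
    rw [Module.finrank_fintype_fun_eq_card, Module.finrank_fintype_fun_eq_card,
      ← Nat.card_eq_fintype_card (α := T), Nat.card_coe_set_eq,
      Fintype.card_subtype_compl, Fintype.card_subtype_eq]
    omega
  obtain ⟨u, hu⟩ := (LinearMap.injective_iff_surjective_of_finrank_eq_finrank hdim).mp hinj z
  exact ⟨ext u, by simp [ext], fun e => congrFun hu e⟩

/-- A Dodgson polynomial `Ψ^{I,J}_K` is nonzero if some set `A` avoiding `I` and `K` is such that
the complements of `I ∪ A` and of `J ∪ A` are spanning trees: the monomial `∏_{e ∈ A} x_e`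
occurs in it. -/
theorem dodgson_ne_zero {G : Multigraph} {v₀ : G.V} {I J K A : Set G.E}
    (hIJ : I.ncard = J.ncard) (hAI : Disjoint A I) (hAK : Disjoint A K)
    (hI : ∀ v, G.reachOn (I ∪ A)ᶜ v₀ v) (hJ : ∀ v, G.reachOn (J ∪ A)ᶜ v₀ v)
    (hcard : (J ∪ A)ᶜ.ncard + 1 = Fintype.card G.V) : G.dodgson v₀ I J K ≠ 0 := by
  have hne : Nonempty ({e : G.E // e ∉ I} ≃ {e : G.E // e ∉ J}) := by
    refine Finite.card_eq.mp ?_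
    have h₁ := Set.ncard_add_ncard_compl I
    have h₂ := Set.ncard_add_ncard_compl J
    change (Iᶜ).ncard = (Jᶜ).ncard
    omega
  intro hzero
  rw [dodgson, dif_pos hne] at hzero
  set σ := hne.some
  let x : G.E → ℚ := fun e => if e ∈ A then 1 else 0
  have hdet := congrArg (MvPolynomial.aeval x) hzero
  rw [map_zero, ← AlgHom.comp_apply, MvPolynomial.comp_aeval] at hdet
  have hx : (fun e => MvPolynomial.aeval x
      (if e ∈ K then (0 : MvPolynomial G.E ℤ) else MvPolynomial.X e)) = x := by
    funext e
    by_cases he : e ∈ K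
    · simp [he, x, Set.disjoint_right.mp hAK he]
    · simp [he]
  rw [hx, AlgHom.map_det] at hdet
  obtain ⟨p, hp, hker⟩ := Matrix.exists_mulVec_eq_zero_iff.mpr hdet
  let y : G.E → ℚ := fun e => if h : e ∉ J then p (Sum.inl (σ.symm ⟨e, h⟩)) else 0
  let w : G.V → ℚ := fun v => if h : v ≠ v₀ then p (Sum.inr ⟨v, h⟩) else 0
  have hyσ : ∀ f, y (σ f).1 = p (Sum.inl f) := by
    intro f
    simp [y, (σ f).2]
  have hwp : ∀ v : {v // v ≠ v₀}, w v.1 = p (Sum.inr v) := by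
    intro v
    simp [w, v.2]
  have hsumE : ∀ g : G.E → ℚ, ∑ f, g (σ f).1 * p (Sum.inl f) = ∑ e, g e * y e := by
    intro g
    rw [← Fintype.sum_subtype_add_sum_subtype (fun e => e ∉ J) (fun e => g e * y e),
      ← σ.sum_comp]
    have : ∑ e : {e // ¬ e ∉ J}, g e.1 * y e.1 = 0 :=
      Finset.sum_eq_zero fun e _ => by simp [y, not_not.mp e.2]
    rw [this, add_zero]
    exact Finset.sum_congr rfl fun f _ => by rw [hyσ]
  have hsumV : ∀ g : G.V → ℚ,
      ∑ v : {v // v ≠ v₀}, g v.1 * p (Sum.inr v) = ∑ v, g v * w v := by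
    intro g
    rw [← Fintype.sum_subtype_add_sum_subtype (fun v => v ≠ v₀) (fun v => g v * w v)]
    have : ∑ v : {v // ¬ v ≠ v₀}, g v.1 * w v.1 = 0 :=
      Finset.sum_eq_zero fun v _ => by simp [w, not_not.mp v.2]
    rw [this, add_zero]
    exact Finset.sum_congr rfl fun v _ => by rw [hwp]
  have hinc : ∀ e v, MvPolynomial.aeval x (G.incCol e v) =
      (if G.src e = v then 1 else 0) - (if G.tgt e = v then (1 : ℚ) else 0) := by
    intro e v
    simp only [incCol, map_sub]
    split_ifs <;> simp
  have hrowE : ∀ e ∉ I, x e * y e + (w (G.src e) - w (G.tgt e)) = 0 := by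
    intro e he
    have h := congrFun hker (Sum.inl ⟨e, he⟩)
    simp only [Matrix.mulVec, dotProduct, Fintype.sum_sum_type, AlgHom.mapMatrix_apply,
      Matrix.map_apply, Matrix.of_apply, bigMatrix, Sum.map_inl, Sum.map_inr, id,
      Pi.zero_apply, hinc] at h
    rw [hsumE fun f => MvPolynomial.aeval x (if e = f then MvPolynomial.X e else 0),
      hsumV fun v => (if G.src e = v then 1 else 0) - (if G.tgt e = v then (1 : ℚ) else 0)] at h
    simpa [apply_ite (MvPolynomial.aeval x), sub_mul, Finset.sum_sub_distrib] using h
  have hrowV : ∀ v ≠ v₀,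
      ∑ e, ((if G.src e = v then 1 else 0) - (if G.tgt e = v then (1 : ℚ) else 0)) * y e = 0 := by
    intro v hv
    have h := congrFun hker (Sum.inr ⟨v, hv⟩)
    simp only [Matrix.mulVec, dotProduct, Fintype.sum_sum_type, AlgHom.mapMatrix_apply,
      Matrix.map_apply, Matrix.of_apply, bigMatrix, Sum.map_inl, Sum.map_inr, id,
      Pi.zero_apply, map_neg, map_zero, zero_mul, Finset.sum_const_zero, add_zero, hinc,
      neg_mul, Finset.sum_neg_distrib, neg_eq_zero] at h
    rwa [hsumE fun e =>
      (if G.src e = v then 1 else 0) - (if G.tgt e = v then (1 : ℚ) else 0)] at h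
  have hw : ∀ v, w v = 0 := by
    intro v
    rw [← eq_of_reachOn (w := w) (fun e he => ?_) (hI v)]
    · simp [w]
    · have := hrowE e fun h => he (Or.inl h)
      rw [show x e = 0 from if_neg fun h => he (Or.inr h)] at this
      linarith
  have hyJA : ∀ e ∈ J ∪ A, y e = 0 := by
    rintro e (heJ | heA)
    · simp [y, heJ]
    · simpa [hw, show x e = 1 from if_pos heA] using hrowE e (Set.disjoint_left.mp hAI heA)
  obtain ⟨u, hu₀, hu⟩ := exists_sub_eq_of_spanning hJ hcard fun e => y e.1
  have hpair : ∑ e, (u (G.src e) - u (G.tgt e)) * y e = 0 := by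
    have hcomm : ∑ v, u v * ∑ e,
        ((if G.src e = v then 1 else 0) - (if G.tgt e = v then (1 : ℚ) else 0)) * y e =
        ∑ e, (u (G.src e) - u (G.tgt e)) * y e := by
      simp_rw [Finset.mul_sum]
      rw [Finset.sum_comm]
      refine Finset.sum_congr rfl fun e _ => ?_
      simp_rw [← mul_assoc]
      rw [← Finset.sum_mul]
      simp [mul_sub, Finset.sum_sub_distrib]
    rw [← hcomm]
    refine Finset.sum_eq_zero fun v _ => ?_
    by_cases hv : v = v₀
    · rw [hv, hu₀, zero_mul]
    · rw [hrowV v hv, mul_zero]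
  have hsq : ∑ e, y e * y e = 0 := by
    rw [← hpair]
    refine Finset.sum_congr rfl fun e _ => ?_
    by_cases he : e ∈ J ∪ A
    · simp [hyJA e he]
    · rw [hu ⟨e, he⟩]
  have hy : ∀ e, y e = 0 := fun e =>
    mul_self_eq_zero.mp
      ((Finset.sum_eq_zero_iff_of_nonneg fun e _ => mul_self_nonneg (y e)).mp hsq e
        (Finset.mem_univ e))
  refine hp (funext fun r => ?_)
  rcases r with f | v
  · rw [← hyσ, hy, Pi.zero_apply]
  · rw [← hwp, hw, Pi.zero_apply]

end Multigraph

end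

/-- Add the vertex set with bit mask `m` to the one with bit mask `R` if they meet. -/
def joinMask (R m : ℕ) : ℕ := if R &&& m = 0 then R else R ||| m

/-- Starting from the vertex set `{0}`, encoded as the bit mask `1`, repeatedly add the ends of
every edge of `T` that meets the current set.  Here `mask e` is the bit mask of the two ends
of `e`. -/
def reachMask {E : Type} (mask : E → ℕ) (T : List E) (rounds : ℕ) : ℕ :=
  (fun R => T.foldl (fun R e => joinMask R (mask e)) R)^[rounds] 1

/-- `X` and `Y` can be completed to spanning trees by adding the same edges of `rest`, in a graph
with `n` vertices. -/
def CommonCompletion {E : Type} (mask : E → ℕ) (n : ℕ) (rest X Y : List E) : Prop :=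
  ∃ B ∈ rest.sublistsLen (n - 1 - X.length),
    reachMask mask (X ++ B) n = 2 ^ n - 1 ∧ reachMask mask (Y ++ B) n = 2 ^ n - 1

instance {E : Type} (mask : E → ℕ) (n : ℕ) (rest X Y : List E) :
    Decidable (CommonCompletion mask n rest X Y) := by
  unfold CommonCompletion
  infer_instance

/-- A combinatorial condition which ensures that all 30 Dodgson polynomials of the
5-configuration `S` are nonzero, where `rest` lists the edges outside `S`. -/
def NonSplitCertificate {E : Type} (mask : E → ℕ) (n : ℕ) (S rest : List E) : Prop :=
  (∀ X ∈ S.sublistsLen 3, ∀ Y ∈ S.sublistsLen 3, (∀ e ∈ S, e ∈ X ∨ e ∈ Y) →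
    CommonCompletion mask n rest X Y) ∧
  ∀ X ∈ S.sublistsLen 2, ∀ Y ∈ S.sublistsLen 2, (∀ e ∈ X, e ∉ Y) →
    CommonCompletion mask n rest X Y

instance {E : Type} [DecidableEq E] (mask : E → ℕ) (n : ℕ) (S rest : List E) :
    Decidable (NonSplitCertificate mask n S rest) := by
  unfold NonSplitCertificate
  infer_instance

namespace Multigraph

/-- The bit mask of the two ends of an edge, for a given numbering of the vertices. -/
def endsMask (G : Multigraph) {n : ℕ} (code : G.V ≃ Fin n) (e : G.E) : ℕ :=
  2 ^ (code (G.src e)).val ||| 2 ^ (code (G.tgt e)).val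

theorem testBit_endsMask {G : Multigraph} {n : ℕ} (code : G.V ≃ Fin n) (e : G.E) (i : ℕ) :
    (G.endsMask code e).testBit i ↔
      (code (G.src e)).val = i ∨ (code (G.tgt e)).val = i := by
  simp [endsMask, Nat.testBit_or, Nat.testBit_two_pow]

/-- Every vertex whose bit is set in `reachMask` can be reached along `T`. -/
theorem reachOn_of_testBit_reachMask {G : Multigraph} {n : ℕ} (code : G.V ≃ Fin n) {v₀ : G.V}
    (hv₀ : (code v₀).val = 0) (T : List G.E) (rounds : ℕ) {v : G.V}
    (hv : (reachMask (G.endsMask code) T rounds).testBit (code v)) :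
    G.reachOn {e | e ∈ T} v₀ v := by
  let Sound (R : ℕ) : Prop := ∀ v, R.testBit (code v) → G.reachOn {e | e ∈ T} v₀ v
  have hedge : ∀ R e, e ∈ T → Sound R →
      Sound (joinMask R (G.endsMask code e)) := by
    intro R e he hR
    unfold joinMask
    split_ifs with hmeet
    · exact hR
    intro v hv
    rw [Nat.testBit_or, Bool.or_eq_true, testBit_endsMask] at hv
    rcases hv with hv | hv
    · exact hR v hv
    obtain ⟨i, hi⟩ := Nat.exists_testBit_of_ne_zero hmeet
    rw [Nat.testBit_and, Bool.and_eq_true, testBit_endsMask] at hi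
    obtain ⟨hiR, hie⟩ := hi
    have hst : G.stepOn {e | e ∈ T} (G.src e) (G.tgt e) := ⟨e, he, Or.inl ⟨rfl, rfl⟩⟩
    have hts : G.stepOn {e | e ∈ T} (G.tgt e) (G.src e) := ⟨e, he, Or.inr ⟨rfl, rfl⟩⟩
    simp only [Fin.val_inj, code.apply_eq_iff_eq] at hv
    rcases hie with rfl | rfl <;> rcases hv with rfl | rfl
    · exact hR _ hiR
    · exact (hR _ hiR).tail hst
    · exact (hR _ hiR).tail hts
    · exact hR _ hiR
  have hfold : ∀ L : List G.E, (∀ e ∈ L, e ∈ T) → ∀ R, Sound R →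
      Sound (L.foldl (fun R e => joinMask R (G.endsMask code e)) R) := by
    intro L
    induction L with
    | nil => exact fun _ R hR => hR
    | cons e L ih =>
      intro hL R hR
      exact ih (fun f hf => hL f (List.mem_cons_of_mem e hf)) _
        (hedge R e (hL e List.mem_cons_self) hR)
  have hone : Sound 1 := by
    intro v hv
    rw [Nat.testBit_one_eq_true_iff_self_eq_zero, ← hv₀, Fin.val_inj,
      code.apply_eq_iff_eq] at hv
    rw [hv]
    exact Relation.ReflTransGen.refl
  have hiter : Sound (reachMask (G.endsMask code) T rounds) := by
    clear hv
    unfold reachMask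
    induction rounds with
    | zero => exact hone
    | succ k ih =>
      rw [Function.iterate_succ_apply']
      exact hfold T (fun _ h => h) _ ih
  exact hiter v hv

/-- A graph with a nonsplit certificate has a 5-configuration which does not split. -/
theorem exists_not_configSplits_of_certificate {G : Multigraph} {n : ℕ} (code : G.V ≃ Fin n)
    (hn : 4 ≤ n) {S rest : List G.E} (hS : S.length = 5) (hnodup : (S ++ rest).Nodup)
    (hcert : NonSplitCertificate (G.endsMask code) n S rest) :
    ∃ S : Set G.E, S.ncard = 5 ∧ ¬ G.ConfigSplits S := by
  classical
  obtain ⟨hSnodup, hrestnodup, hdisj⟩ := List.nodup_append'.mp hnodup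
  have hncard : ∀ L : List G.E, L.Nodup → {e | e ∈ L}.ncard = L.length := by
    intro L hL
    rw [← List.toFinset_card_of_nodup hL, ← Set.ncard_coe_finset, List.coe_toFinset]
  have hcardV : Fintype.card G.V = n := by rw [Fintype.card_congr code, Fintype.card_fin]
  refine ⟨{e | e ∈ S}, (hncard S hSnodup).trans hS, ?_⟩
  rintro ⟨I, J, K, ⟨hunion, hcases⟩, hzero⟩
  have hIS : ∀ e ∈ I, e ∈ S := fun e he => hunion.subset (Or.inl (Or.inl he))
  have hJS : ∀ e ∈ J, e ∈ S := fun e he => hunion.subset (Or.inl (Or.inr he))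
  have hKS : ∀ e ∈ K, e ∈ S := fun e he => hunion.subset (Or.inr he)
  have hlen : ∀ L : Set G.E, (∀ e ∈ L, e ∈ S) →
      (S.filter (· ∉ L)).length + L.ncard = 5 := by
    intro L hL
    rw [← hncard _ (hSnodup.filter _), ← hS, ← hncard S hSnodup,
      ← Set.ncard_sdiff_add_ncard_of_subset (show L ⊆ {e | e ∈ S} from hL)]
    congr 2
    ext e
    simp
  let X := S.filter (· ∉ I)
  let Y := S.filter (· ∉ J)
  have hmem : ∀ L : Set G.E, (S.filter (· ∉ L)) ∈ S.sublistsLen (S.filter (· ∉ L)).length :=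
    fun L => List.mem_sublistsLen.mpr ⟨List.filter_sublist, rfl⟩
  have hIJ : I.ncard = J.ncard ∧ (I.ncard = 2 ∨ I.ncard = 3) := by
    rcases hcases with h | h <;> omega
  have hXlen : X.length + I.ncard = 5 := hlen I hIS
  have hYlen : Y.length + J.ncard = 5 := hlen J hJS
  have hcompl : CommonCompletion (G.endsMask code) n rest X Y := by
    have hXmem : X ∈ S.sublistsLen X.length := hmem I
    have hYmem : Y ∈ S.sublistsLen Y.length := hmem J
    rcases hcases with ⟨hI, hJ, -, hdis, -, -⟩ | ⟨hI, hJ, hK, -⟩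
    · rw [show X.length = 3 by omega] at hXmem
      rw [show Y.length = 3 by omega] at hYmem
      refine hcert.1 X hXmem Y hYmem fun e he => ?_
      by_contra! hcon
      have hmemIJ : e ∈ I ∩ J := by simpa [X, Y, he] using hcon
      rwa [hdis] at hmemIJ
    · rw [show X.length = 2 by omega] at hXmem
      rw [show Y.length = 2 by omega] at hYmem
      refine hcert.2 X hXmem Y hYmem fun e heX heY => ?_
      simp only [X, Y, List.mem_filter, decide_eq_true_eq] at heX heY
      rcases hunion.superset heX.1 with (h | h) | h
      · exact heX.2 h
      · exact heY.2 h
      · rwa [hK] at h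
  obtain ⟨B, hB, hspanX, hspanY⟩ := hcompl
  obtain ⟨hBrest, hBlen⟩ := List.mem_sublistsLen.mp hB
  have hBS : ∀ e ∈ B, e ∉ S := fun e he heS => hdisj heS (hBrest.subset he)
  let A : Set G.E := {e | e ∉ S ∧ e ∉ B}
  have hset : ∀ L : Set G.E, (∀ e ∈ L, e ∈ S) →
      (L ∪ A)ᶜ = {e | e ∈ S.filter (· ∉ L) ++ B} := by
    intro L hL
    ext e
    have h₁ := hL e
    have h₂ := hBS e
    simp only [A, Set.mem_compl_iff, Set.mem_union, Set.mem_ofPred_eq, List.mem_append,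
      List.mem_filter, decide_eq_true_eq]
    tauto
  have hreach : ∀ T : List G.E, reachMask (G.endsMask code) T n = 2 ^ n - 1 →
      ∀ v, G.reachOn {e | e ∈ T} (code.symm ⟨0, by omega⟩) v := by
    intro T hT v
    refine reachOn_of_testBit_reachMask code (by simp) T n ?_
    rw [hT, Nat.testBit_two_pow_sub_one]
    simp
  have hdisjA : ∀ L : Set G.E, (∀ e ∈ L, e ∈ S) → Disjoint A L := fun L hL =>
    Set.disjoint_left.mpr fun e he heL => he.1 (hL e heL)
  refine dodgson_ne_zero (v₀ := code.symm ⟨0, by omega⟩) hIJ.1 (hdisjA I hIS)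
    (hdisjA K hKS) ?_ ?_ ?_ (hzero _)
  · rw [hset I hIS]
    exact hreach _ hspanX
  · rw [hset J hJS]
    exact hreach _ hspanY
  · have hYB : (Y ++ B).Nodup := (hSnodup.filter _).append (hrestnodup.sublist hBrest)
      fun e heY heB => hBS e heB (List.mem_of_mem_filter heY)
    rw [hset J hJS, hncard _ hYB, List.length_append, hBlen, hcardV]
    omega

instance : DecidableEq K33m.E := inferInstanceAs (DecidableEq (Fin 3 × Fin 3))

instance : DecidableEq K5m.E := inferInstanceAs (DecidableEq {p : Fin 5 × Fin 5 // p.1 < p.2})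

instance : DecidableEq cubeM.E := inferInstanceAs (DecidableEq (Fin 3 × Fin 2 × Fin 2))

instance : DecidableEq octaM.E :=
  inferInstanceAs (DecidableEq {p : (Fin 3 × Fin 2) × (Fin 3 × Fin 2) // p.1.1 < p.2.1})

instance : DecidableEq Hm.E :=
  inferInstanceAs (DecidableEq {p : Fin 7 × Fin 7 // p ∈ hEdgeList})

/-- The edge of `K₅` joining `i < j`. -/
def K5Edge (i j : Fin 5) (h : i < j := by decide) : K5m.E := ⟨(i, j), h⟩

/-- The edge of the octahedron joining `a` and `b`. -/
def octaEdge (a b : Fin 3 × Fin 2) (h : a.1 < b.1 := by decide) : octaM.E := ⟨(a, b), h⟩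

/-- The edge of `H` listed as `(i, j)`. -/
def HEdge (i j : Fin 7) (h : (i, j) ∈ hEdgeList := by decide) : Hm.E := ⟨(i, j), h⟩

theorem exists_not_configSplits_K33m :
    ∃ S : Set K33m.E, S.ncard = 5 ∧ ¬ K33m.ConfigSplits S :=
  exists_not_configSplits_of_certificate finSumFinEquiv (by decide)
    (S := [(0, 0), (0, 1), (1, 0), (1, 1), (2, 2)])
    (rest := [(0, 2), (1, 2), (2, 0), (2, 1)]) rfl (by decide +kernel) (by decide +kernel)

theorem exists_not_configSplits_K5m :
    ∃ S : Set K5m.E, S.ncard = 5 ∧ ¬ K5m.ConfigSplits S :=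
  exists_not_configSplits_of_certificate (Equiv.refl (Fin 5)) (by decide)
    (S := [K5Edge 0 1, K5Edge 0 2, K5Edge 0 3, K5Edge 1 4, K5Edge 2 4])
    (rest := [K5Edge 0 4, K5Edge 1 2, K5Edge 1 3, K5Edge 2 3, K5Edge 3 4])
    rfl (by decide +kernel) (by decide +kernel)

/-- The numbering of the vertices of the cube by binary expansion. -/
def cubeCode : cubeM.V ≃ Fin 8 :=
  ((Equiv.refl (Fin 2)).prodCongr finProdFinEquiv).trans finProdFinEquiv

/-- A form of `cubeM.endsMask cubeCode` that reduces in the kernel. -/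
def cubeMask (e : cubeM.E) : ℕ :=
  match e with
  | (0, i, j) => 2 ^ (2 * i.val + j) ||| 2 ^ (4 + 2 * i.val + j)
  | (1, i, j) => 2 ^ (4 * i.val + j) ||| 2 ^ (4 * i.val + 2 + j)
  | (2, i, j) => 2 ^ (4 * i.val + 2 * j) ||| 2 ^ (4 * i.val + 2 * j + 1)

theorem endsMask_cubeCode : cubeM.endsMask cubeCode = cubeMask := by
  funext ⟨k, i, j⟩
  fin_cases k <;> fin_cases i <;> fin_cases j <;>
    simp [endsMask, cubeM, cubeMask] <;> rfl

theorem exists_not_configSplits_cubeM :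
    ∃ S : Set cubeM.E, S.ncard = 5 ∧ ¬ cubeM.ConfigSplits S :=
  exists_not_configSplits_of_certificate cubeCode (by decide)
    (S := [(0, 0, 0), (0, 0, 1), (0, 1, 0), (0, 1, 1), (1, 0, 0)])
    (rest := [(1, 0, 1), (1, 1, 0), (1, 1, 1), (2, 0, 0), (2, 0, 1), (2, 1, 0), (2, 1, 1)])
    rfl (by decide +kernel) (by rw [endsMask_cubeCode]; decide +kernel)

theorem exists_not_configSplits_octaM :
    ∃ S : Set octaM.E, S.ncard = 5 ∧ ¬ octaM.ConfigSplits S :=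
  exists_not_configSplits_of_certificate finProdFinEquiv (by decide)
    (S := [octaEdge (0, 0) (1, 0), octaEdge (0, 0) (1, 1), octaEdge (0, 0) (2, 0),
      octaEdge (0, 0) (2, 1), octaEdge (0, 1) (1, 0)])
    (rest := [octaEdge (0, 1) (1, 1), octaEdge (0, 1) (2, 0), octaEdge (0, 1) (2, 1),
      octaEdge (1, 0) (2, 0), octaEdge (1, 0) (2, 1), octaEdge (1, 1) (2, 0),
      octaEdge (1, 1) (2, 1)])
    rfl (by decide +kernel) (by decide +kernel)

theorem exists_not_configSplits_Hm :
    ∃ S : Set Hm.E, S.ncard = 5 ∧ ¬ Hm.ConfigSplits S :=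
  exists_not_configSplits_of_certificate (Equiv.refl (Fin 7)) (by decide)
    (S := [HEdge 0 1, HEdge 0 2, HEdge 0 3, HEdge 0 4, HEdge 1 5])
    (rest := [HEdge 1 2, HEdge 1 3, HEdge 2 4, HEdge 2 5, HEdge 3 6, HEdge 4 6, HEdge 5 6])
    rfl (by decide +kernel) (by decide +kernel)

end Multigraph

open Multigraph

theorem stmt7 :
    ∀ G ∈ [K33m, K5m, cubeM, octaM, Hm],
      ¬ G.FeynmanSplit ∧ ∃ S : Set G.E, S.ncard = 5 ∧ ¬ G.ConfigSplits S := by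
  have hnot : ∀ G : Multigraph, (∃ S : Set G.E, S.ncard = 5 ∧ ¬ G.ConfigSplits S) →
      ¬ G.FeynmanSplit ∧ ∃ S : Set G.E, S.ncard = 5 ∧ ¬ G.ConfigSplits S :=
    fun G ⟨S, hS, hsplit⟩ => ⟨fun h => hsplit (h S hS), S, hS, hsplit⟩
  simp only [List.forall_mem_cons, List.not_mem_nil, IsEmpty.forall_iff, implies_true, and_true]
  exact ⟨hnot _ exists_not_configSplits_K33m, hnot _ exists_not_configSplits_K5m,
    hnot _ exists_not_configSplits_cubeM, hnot _ exists_not_configSplits_octaM,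
    hnot _ exists_not_configSplits_Hm⟩
end
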